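/- arXiv:math/0203273 — 3 statements merged into one kernel-verified Lean document; each statement's English description precedes it below -/
import Mathlib

section
/- Let K be a field and let C be a small K-linear category which is Wedderburn, i.e. for every object X the Jacobson radical J(End(X)) of the endomorphism algebra End(X) is nilpotent and the quotient End(X)/J(End(X)) is a separable K-algebra. Then the projection of C onto its quotient by the radical admits a functorial K-linear section: there exists a family of K-linear maps σ_{X,Y} : Hom(X,Y) → Hom(X,Y), for all objects X, Y, such that σ(f) − f ∈ rad(X,Y) for every f, σ(f) = σ(f′) whenever f − f′ ∈ rad(X,Y), σ(𝟙_X) = 𝟙_X for every object X, and σ(f ≫ g) = σ(f) ≫ σ(g) for all composable f, g. -/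
open CategoryTheory TensorProduct

universe u v

/-- A subset `S` of a (possibly noncommutative) ring is *nilpotent* if there is an `n ≥ 1`
such that every product of `n` elements of `S` vanishes. -/
def IsNilpotentSet {R : Type*} [Ring R] (S : Set R) : Prop :=
  ∃ n : ℕ, 0 < n ∧ ∀ l : List R, (∀ x ∈ l, x ∈ S) → l.length = n → l.prod = 0

/-- A `K`-algebra `B` is *separable* (or absolutely semisimple) if `L ⊗[K] B` is a
semisimple ring for every field extension `L/K`. -/
def IsSeparableKAlgebra (K : Type u) [Field K] (B : Type v) [Ring B] [Algebra K B] : Prop :=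
  ∀ (L : Type u) [Field L] [Algebra K L], IsSemisimpleRing (TensorProduct K L B)

/-- The relation on a ring identifying two elements whose difference lies in the Jacobson
radical (the intersection of the maximal left ideals). -/
def jacRel (A : Type*) [Ring A] : A → A → Prop :=
  fun a b => a - b ∈ Ideal.jacobson (⊥ : Ideal A)

/-- The quotient of a ring by its Jacobson radical (which is a two-sided ideal), realized
as a `RingQuot`. -/
abbrev JacQuot (A : Type*) [Ring A] := RingQuot (jacRel A)

/-- The radical of a preadditive category: a morphism `f : X ⟶ Y` belongs to the radical
iff `𝟙 X - f ≫ g` is invertible (a unit of the endomorphism ring of `X`) for every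
`g : Y ⟶ X`. -/
def catRadical {C : Type*} [Category C] [Preadditive C] (X Y : C) : Set (X ⟶ Y) :=
  {f | ∀ g : Y ⟶ X, IsIso (𝟙 X - f ≫ g)}

/-- `C` is a *Wedderburn* `K`-linear category: for every object `X` the Jacobson radical of
the endomorphism algebra `End X` is nilpotent, and `End X` modulo its Jacobson radical is
a separable `K`-algebra. -/
def IsWedderburnCat (K : Type u) [Field K] (C : Type v) [SmallCategory C] [Preadditive C]
    [CategoryTheory.Linear K C] : Prop :=
  ∀ X : C,
    IsNilpotentSet (Ideal.jacobson (⊥ : Ideal (End X)) : Set (End X)) ∧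
    IsSeparableKAlgebra K (JacQuot (End X))

/-- A functorial `K`-linear section of the projection of `C` onto its quotient by the
radical: a family of `K`-linear maps `σ X Y : (X ⟶ Y) →ₗ[K] (X ⟶ Y)` such that
`σ f - f` is in the radical, `σ` only depends on `f` modulo the radical, `σ` preserves
identities and `σ` is compatible with composition. -/
def IsFunctorialSection (K : Type u) [Field K] {C : Type v} [SmallCategory C] [Preadditive C]
    [CategoryTheory.Linear K C] (σ : ∀ X Y : C, (X ⟶ Y) →ₗ[K] (X ⟶ Y)) : Prop :=
  (∀ (X Y : C) (f : X ⟶ Y), σ X Y f - f ∈ catRadical X Y) ∧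
  (∀ (X Y : C) (f f' : X ⟶ Y), f - f' ∈ catRadical X Y → σ X Y f = σ X Y f') ∧
  (∀ X : C, σ X X (𝟙 X) = 𝟙 X) ∧
  (∀ (X Y Z : C) (f : X ⟶ Y) (g : Y ⟶ Z), σ X Z (f ≫ g) = σ X Y f ≫ σ Y Z g)

section Separability

open Polynomial

/-- The canonical map from `R[X]` to the base change of `R` to the field of rational functions. -/
noncomputable def polyToFractionTensor (F : Type*) [Field F] (R : Type*) [Ring R] [Algebra F R] :
    R[X] →ₐ[F] FractionRing F[X] ⊗[F] R :=
  (Algebra.TensorProduct.map (Algebra.ofId F[X] (FractionRing F[X]) |>.restrictScalars F)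
    (AlgHom.id F R)).comp
    ((Algebra.TensorProduct.comm F R F[X]).toAlgHom.comp (polyEquivTensor F R).toAlgHom)

section

variable {F : Type*} [Field F] {R : Type*} [Ring R] [Algebra F R]

lemma polyToFractionTensor_injective : Function.Injective (polyToFractionTensor F R) := by
  have h : Function.Injective
      (LinearMap.rTensor R (Algebra.ofId F[X] (FractionRing F[X]) |>.restrictScalars F).toLinearMap) :=
    Module.Flat.rTensor_preserves_injective_linearMap _
      (IsFractionRing.injective F[X] (FractionRing F[X]))
  exact h.comp ((Algebra.TensorProduct.comm F R F[X]).injective.comp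
    (polyEquivTensor F R).injective)

lemma polyToFractionTensor_symm_tmul (p : F[X]) (r : R) :
    polyToFractionTensor F R (r • p.map (algebraMap F R)) =
      algebraMap F[X] (FractionRing F[X]) p ⊗ₜ r := by
  rw [← polyEquivTensor_symm_apply_tmul_eq_smul]
  change (Algebra.TensorProduct.map _ _) ((Algebra.TensorProduct.comm F R F[X])
    (polyEquivTensor F R ((polyEquivTensor F R).symm (r ⊗ₜ p)))) = _
  rw [AlgEquiv.apply_symm_apply, Algebra.TensorProduct.comm_tmul, Algebra.TensorProduct.map_tmul]
  rfl

lemma polyToFractionTensor_map (p : F[X]) :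
    polyToFractionTensor F R (p.map (algebraMap F R)) =
      algebraMap F[X] (FractionRing F[X]) p ⊗ₜ 1 := by
  simpa using polyToFractionTensor_symm_tmul p (1 : R)

lemma exists_mul_eq_polyToFractionTensor (w : FractionRing F[X] ⊗[F] R) :
    ∃ p : F[X], p ≠ 0 ∧ ∃ q : R[X],
      (algebraMap F[X] (FractionRing F[X]) p ⊗ₜ 1) * w = polyToFractionTensor F R q := by
  induction w with
  | zero => exact ⟨1, one_ne_zero, 0, by simp⟩
  | tmul a r =>
    obtain ⟨n, d, rfl⟩ := IsLocalization.exists_mk'_eq (nonZeroDivisors F[X]) a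
    refine ⟨d, nonZeroDivisors.ne_zero d.2, r • n.map (algebraMap F R), ?_⟩
    rw [polyToFractionTensor_symm_tmul, Algebra.TensorProduct.tmul_mul_tmul, one_mul,
      IsLocalization.mk'_spec']
  | add a b ha hb =>
    obtain ⟨p, hp, q, h⟩ := ha
    obtain ⟨p', hp', q', h'⟩ := hb
    refine ⟨p * p', mul_ne_zero hp hp',
      p'.map (algebraMap F R) * q + p.map (algebraMap F R) * q', ?_⟩
    rw [map_add, map_mul, map_mul, map_mul, ← h, ← h', polyToFractionTensor_map,
      polyToFractionTensor_map, mul_add, ← mul_assoc, ← mul_assoc]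
    simp [mul_comm]

/-- If the base change of `R` to the field of rational functions is semisimple, then `R` is
algebraic over the base field. -/
lemma isIntegral_of_isSemisimpleRing_fractionRing_tensor
    [IsSemisimpleRing (FractionRing F[X] ⊗[F] R)] (x : R) : IsIntegral F x := by
  nontriviality R
  set ψ := polyToFractionTensor F R
  have hcancel (p : F[X]) (hp : p ≠ 0) (w : FractionRing F[X] ⊗[F] R)
      (h : (algebraMap F[X] (FractionRing F[X]) p ⊗ₜ 1) * w = 0) : w = 0 := by
    have hp' : algebraMap F[X] (FractionRing F[X]) p ≠ 0 := by simpa using hp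
    calc w = ((algebraMap F[X] (FractionRing F[X]) p)⁻¹ ⊗ₜ 1) *
          ((algebraMap F[X] (FractionRing F[X]) p ⊗ₜ 1) * w) := by
          rw [← mul_assoc, Algebra.TensorProduct.tmul_mul_tmul, inv_mul_cancel₀ hp', one_mul,
            ← Algebra.TensorProduct.one_def, one_mul]
      _ = 0 := by rw [h, mul_zero]
  let f : (FractionRing F[X] ⊗[F] R) →ₗ[FractionRing F[X] ⊗[F] R] (FractionRing F[X] ⊗[F] R) :=
    LinearMap.toSpanSingleton _ _ (ψ (X - C x))
  have hf : Function.Injective f := by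
    rw [injective_iff_map_eq_zero]
    intro w hw
    obtain ⟨p, hp, q, hq⟩ := exists_mul_eq_polyToFractionTensor w
    have hw : w * ψ (X - C x) = 0 := hw
    have h0 : ψ (q * (X - C x)) = 0 := by
      rw [map_mul, ← hq, mul_assoc, hw, mul_zero]
    have h1 : q * (X - C x) = 0 := polyToFractionTensor_injective (by rw [h0, map_zero])
    have h2 : q = 0 := (monic_X_sub_C x).mul_left_eq_zero_iff.mp h1
    exact hcancel p hp w (by rw [hq, h2, map_zero])
  obtain ⟨z, hz⟩ := IsArtinian.surjective_of_injective_endomorphism f hf 1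
  have hz : z * ψ (X - C x) = 1 := hz
  obtain ⟨p, hp, q, hq⟩ := exists_mul_eq_polyToFractionTensor z
  have h1 : q * (X - C x) = p.map (algebraMap F R) := by
    apply polyToFractionTensor_injective (F := F)
    rw [map_mul, ← hq, mul_assoc, hz, mul_one, polyToFractionTensor_map]
  have h2 : aeval x p = 0 := by
    rw [← eval_map_algebraMap, ← h1, eval_mul_X_sub_C]
  exact isAlgebraic_iff_isIntegral.mp ⟨p, hp, h2⟩

end

/-- An element `e` of `B ⊗ B` is a separability element if it is sent to `1` by multiplication
and satisfies `b e = e b` for all `b`. -/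
def IsSeparabilityElement (K : Type*) [CommRing K] {B : Type*} [Ring B] [Algebra K B]
    (e : B ⊗[K] B) : Prop :=
  LinearMap.mul' K B e = 1 ∧ ∀ b : B,
    TensorProduct.map (LinearMap.mulLeft K b) LinearMap.id e =
      TensorProduct.map LinearMap.id (LinearMap.mulRight K b) e

lemma IsSeparabilityElement.map {K : Type*} [CommRing K] {B B' : Type*} [Ring B] [Algebra K B]
    [Ring B'] [Algebra K B'] {e : B ⊗[K] B} (he : IsSeparabilityElement K e) (f : B →ₐ[K] B')
    (hf : Function.Surjective f) :
    IsSeparabilityElement K (TensorProduct.map f.toLinearMap f.toLinearMap e) := by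
  constructor
  · have h : LinearMap.mul' K B' ∘ₗ TensorProduct.map f.toLinearMap f.toLinearMap =
        f.toLinearMap ∘ₗ LinearMap.mul' K B := by
      ext; simp
    have h' := LinearMap.congr_fun h e
    simpa [he.1] using h'
  · intro b
    obtain ⟨b, rfl⟩ := hf b
    have h1 : TensorProduct.map (LinearMap.mulLeft K (f b)) LinearMap.id ∘ₗ
        TensorProduct.map f.toLinearMap f.toLinearMap =
        TensorProduct.map f.toLinearMap f.toLinearMap ∘ₗ
          TensorProduct.map (LinearMap.mulLeft K b) LinearMap.id := by
      ext; simp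
    have h2 : TensorProduct.map LinearMap.id (LinearMap.mulRight K (f b)) ∘ₗ
        TensorProduct.map f.toLinearMap f.toLinearMap =
        TensorProduct.map f.toLinearMap f.toLinearMap ∘ₗ
          TensorProduct.map LinearMap.id (LinearMap.mulRight K b) := by
      ext; simp
    have h1' := LinearMap.congr_fun h1 e
    have h2' := LinearMap.congr_fun h2 e
    simp only [LinearMap.comp_apply] at h1' h2'
    rw [h1', h2', he.2]

lemma exists_isSeparabilityElement_pi_matrix (F : Type*) [Field F] {n : ℕ} (d : Fin n → ℕ)
    [∀ i, NeZero (d i)] :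
    ∃ e : (Π i, Matrix (Fin (d i)) (Fin (d i)) F) ⊗[F] (Π i, Matrix (Fin (d i)) (Fin (d i)) F),
      IsSeparabilityElement F e := by
  refine ⟨∑ i, ∑ j, Pi.single i (Matrix.single j 0 1) ⊗ₜ Pi.single i (Matrix.single 0 j 1), ?_, ?_⟩
  · simp only [map_sum, LinearMap.mul'_apply, ← Pi.single_mul, Matrix.single_mul_single_same, mul_one]
    rw [← Finset.univ_sum_single (1 : Π i, Matrix (Fin (d i)) (Fin (d i)) F)]
    refine Finset.sum_congr rfl fun i _ ↦ ?_
    rw [Pi.one_apply, ← Matrix.sum_single_one]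
    exact (map_sum (AddMonoidHom.single (fun i ↦ Matrix (Fin (d i)) (Fin (d i)) F) i) _ _).symm
  · intro b
    simp only [map_sum, TensorProduct.map_tmul, LinearMap.mulLeft_apply, LinearMap.mulRight_apply,
      LinearMap.id_apply]
    refine Finset.sum_congr rfl fun i _ ↦ ?_
    have hs (f : Fin (d i) → Matrix (Fin (d i)) (Fin (d i)) F) :
        (Pi.single i (∑ l, f l) : Π i, Matrix (Fin (d i)) (Fin (d i)) F) =
          ∑ l, Pi.single i (f l) :=
      map_sum (AddMonoidHom.single (fun i ↦ Matrix (Fin (d i)) (Fin (d i)) F) i) _ _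
    have h1 (j : Fin (d i)) : b * Pi.single i (Matrix.single j 0 1) =
        ∑ l, b i l j • (Pi.single i (Matrix.single l 0 1) :
          Π i, Matrix (Fin (d i)) (Fin (d i)) F) := by
      have h : b i * Matrix.single j 0 1 = ∑ l, b i l j • Matrix.single l 0 1 := by
        ext k l
        simp [Matrix.sum_apply, Matrix.mul_apply, Matrix.single_apply, ite_and]
      rw [← Pi.single_mul_right, h, hs]
      simp only [← Pi.single_smul]
    have h2 (j : Fin (d i)) : Pi.single i (Matrix.single 0 j 1) * b =
        ∑ l, b i j l • (Pi.single i (Matrix.single 0 l 1) :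
          Π i, Matrix (Fin (d i)) (Fin (d i)) F) := by
      have h : Matrix.single 0 j 1 * b i = ∑ l, b i j l • Matrix.single 0 l 1 := by
        ext k l
        simp [Matrix.sum_apply, Matrix.mul_apply, Matrix.single_apply, ite_and]
      rw [← Pi.single_mul_left, h, hs]
      simp only [← Pi.single_smul]
    simp only [h1, h2, TensorProduct.sum_tmul, TensorProduct.tmul_sum, TensorProduct.smul_tmul]
    exact Finset.sum_comm

/-- A semisimple algebra over an algebraically closed field all of whose elements are algebraic
is a finite product of matrix algebras. -/
lemma exists_algEquiv_pi_matrix_of_isIntegral (F R : Type*) [Field F] [IsAlgClosed F] [Ring R]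
    [Algebra F R] [IsSemisimpleRing R] (hR : ∀ x : R, IsIntegral F x) :
    ∃ (n : ℕ) (d : Fin n → ℕ), (∀ i, NeZero (d i)) ∧
      Nonempty (R ≃ₐ[F] Π i, Matrix (Fin (d i)) (Fin (d i)) F) := by
  obtain ⟨n, D, d, _, _, hd, ⟨e⟩⟩ := IsSemisimpleRing.exists_algEquiv_pi_matrix_divisionRing F R
  have hD (i : Fin n) : Algebra.IsIntegral F (D i) := by
    refine ⟨fun x ↦ ?_⟩
    let y : Π i, Matrix (Fin (d i)) (Fin (d i)) (D i) := Pi.single i (Matrix.scalar _ x)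
    have h1 : IsIntegral F (e.symm y) := hR _
    have h2 : IsIntegral F y := by simpa using h1.map e.toAlgHom
    have h3 : IsIntegral F (Matrix.scalar (Fin (d i)) x) := by
      simpa [y] using h2.map (Pi.evalAlgHom F (fun i ↦ Matrix (Fin (d i)) (Fin (d i)) (D i)) i)
    let g : D i →ₐ[F] Matrix (Fin (d i)) (Fin (d i)) (D i) :=
      { Matrix.scalar (Fin (d i)) with
        commutes' := fun r ↦ rfl }
    exact (isIntegral_algHom_iff g (RingHom.injective g.toRingHom)).mp h3
  exact ⟨n, d, hd, ⟨e.trans <| .piCongrRight fun i ↦ .mapMatrix <| .symm <| .ofBijective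
    (Algebra.ofId F (D i)) IsAlgClosed.algebraMap_bijective_of_isIntegral⟩⟩

lemma addMonoidHom_ext_tensor_baseChange {K L B M : Type*} [CommRing K] [CommRing L] [Algebra K L]
    [AddCommGroup B] [Module K B] [AddCommGroup M] {f g : (L ⊗[K] B) ⊗[L] (L ⊗[K] B) →+ M}
    (h : ∀ l l' b b', f ((l ⊗ₜ b) ⊗ₜ (l' ⊗ₜ b')) = g ((l ⊗ₜ b) ⊗ₜ (l' ⊗ₜ b'))) : f = g := by
  ext x
  induction x with
  | zero => simp
  | add x y hx hy => simp [hx, hy]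
  | tmul x y =>
    induction x with
    | zero => simp
    | add x x' hx hx' => simp [hx, hx', add_tmul]
    | tmul l b =>
      induction y with
      | zero => simp
      | add y y' hy hy' => simp [hy, hy', tmul_add]
      | tmul l' b' => exact h l l' b b'

/-- Separability elements descend along field extensions. -/
lemma exists_isSeparabilityElement_of_baseChange {K : Type*} [Field K] (L : Type*) [Field L]
    [Algebra K L] {B : Type*} [Ring B] [Algebra K B] {e : (L ⊗[K] B) ⊗[L] (L ⊗[K] B)}
    (he : IsSeparabilityElement L e) : ∃ e : B ⊗[K] B, IsSeparabilityElement K e := by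
  obtain ⟨φ, hφ⟩ : ∃ φ : L →ₗ[K] K, φ 1 = 1 := by
    obtain ⟨φ, hφ⟩ := LinearMap.exists_leftInverse_of_injective (Algebra.linearMap K L)
      (LinearMap.ker_eq_bot.mpr (algebraMap K L).injective)
    exact ⟨φ, by simpa using LinearMap.congr_fun hφ 1⟩
  let r (M : Type _) [AddCommGroup M] [Module K M] : L ⊗[K] M →ₗ[K] M :=
    (TensorProduct.lid K M).toLinearMap ∘ₗ LinearMap.rTensor M φ
  let Θ : (L ⊗[K] B) ⊗[L] (L ⊗[K] B) →ₗ[K] B ⊗[K] B :=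
    r (B ⊗[K] B) ∘ₗ
      (AlgebraTensorModule.distribBaseChange K L B B).symm.toLinearMap.restrictScalars K
  have hΘ (l l' : L) (b b' : B) : Θ ((l ⊗ₜ b) ⊗ₜ (l' ⊗ₜ b')) = φ (l * l') • (b ⊗ₜ b') := by
    simp [Θ, r]
  refine ⟨Θ e, ?_, fun b ↦ ?_⟩
  · have h : (LinearMap.mul' K B).toAddMonoidHom.comp Θ.toAddMonoidHom =
        (r B).toAddMonoidHom.comp (LinearMap.mul' L (L ⊗[K] B)).toAddMonoidHom :=
      addMonoidHom_ext_tensor_baseChange fun l l' b b' ↦ by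
        simp [hΘ, r]
    have h' : LinearMap.mul' K B (Θ e) = r B (LinearMap.mul' L (L ⊗[K] B) e) :=
      DFunLike.congr_fun h e
    rw [h', he.1, Algebra.TensorProduct.one_def]
    simp [r, hφ]
  · have h1 : (TensorProduct.map (LinearMap.mulLeft K b) LinearMap.id ∘ₗ Θ).toAddMonoidHom =
        Θ.toAddMonoidHom.comp (TensorProduct.map
          (LinearMap.mulLeft L ((1 : L) ⊗ₜ[K] b)) LinearMap.id).toAddMonoidHom :=
      addMonoidHom_ext_tensor_baseChange fun l l' b b' ↦ by simp [hΘ]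
    have h2 : (TensorProduct.map LinearMap.id (LinearMap.mulRight K b) ∘ₗ Θ).toAddMonoidHom =
        Θ.toAddMonoidHom.comp (TensorProduct.map LinearMap.id
          (LinearMap.mulRight L ((1 : L) ⊗ₜ[K] b))).toAddMonoidHom :=
      addMonoidHom_ext_tensor_baseChange fun l l' b b' ↦ by simp [hΘ]
    refine (DFunLike.congr_fun h1 e).trans (Eq.trans ?_ (DFunLike.congr_fun h2 e).symm)
    exact congrArg Θ (he.2 _)

theorem IsSeparableKAlgebra.exists_isSeparabilityElement {K : Type u} [Field K] {B : Type v}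
    [Ring B] [Algebra K B] (hB : IsSeparableKAlgebra K B) :
    ∃ e : B ⊗[K] B, IsSeparabilityElement K e := by
  let F := AlgebraicClosure K
  have : IsSemisimpleRing (F ⊗[K] B) := hB F
  have : IsSemisimpleRing (FractionRing F[X] ⊗[K] B) := hB _
  have : IsSemisimpleRing (FractionRing F[X] ⊗[F] (F ⊗[K] B)) :=
    (AlgEquiv.ofLinearEquiv
      (AlgebraTensorModule.cancelBaseChange K F F (FractionRing F[X]) B).symm
      (by simp [Algebra.TensorProduct.one_def])
      (LinearMap.map_mul_of_map_mul_tmul fun _ _ _ _ ↦ by simp)).toRingEquiv.isSemisimpleRing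
  obtain ⟨n, d, hd, ⟨f⟩⟩ := exists_algEquiv_pi_matrix_of_isIntegral F (F ⊗[K] B)
    isIntegral_of_isSemisimpleRing_fractionRing_tensor
  obtain ⟨e, he⟩ := exists_isSeparabilityElement_pi_matrix F d
  exact exists_isSeparabilityElement_of_baseChange F (he.map f.symm.toAlgHom f.symm.surjective)

lemma IsSeparableKAlgebra.isSemisimpleRing {K : Type u} [Field K] {B : Type v}
    [Ring B] [Algebra K B] (hB : IsSeparableKAlgebra K B) : IsSemisimpleRing B :=
  have := hB K
  (Algebra.TensorProduct.lid K B).toRingEquiv.isSemisimpleRing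

end Separability

section Wedderburn

/-- One step of lifting: a linear map which is multiplicative modulo `I ^ k` can be corrected
by a map with values in `I ^ k` to become multiplicative modulo `I ^ (k + 1)`. -/
lemma exists_linearMap_mul_sub_mem_pow_succ {K A B : Type*} [CommRing K] [Ring A] [Algebra K A]
    [Ring B] [Algebra K B] {e : B ⊗[K] B} (he : IsSeparabilityElement K e) (I : Submodule K A)
    (hl : ∀ a, ∀ x ∈ I, a * x ∈ I) {k : ℕ} (hk : 0 < k)
    (s : B →ₗ[K] A) (hs1 : 1 - s 1 ∈ I) (hs : ∀ a b, s (a * b) - s a * s b ∈ I ^ k) :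
    ∃ s' : B →ₗ[K] A, (∀ b, s' b - s b ∈ I) ∧
      ∀ a b, s' (a * b) - s' a * s' b ∈ I ^ (k + 1) := by
  have hle : I ^ k ≤ I := by
    obtain ⟨m, rfl⟩ := Nat.exists_eq_add_of_lt hk
    rw [zero_add, pow_succ]
    exact Submodule.mul_le.mpr fun a _ x hx ↦ hl a x hx
  have hlk (a x : A) (hx : x ∈ I ^ k) : a * x ∈ I ^ k := by
    obtain ⟨m, rfl⟩ := Nat.exists_eq_add_of_lt hk
    rw [zero_add, pow_succ'] at hx ⊢
    refine Submodule.mul_induction_on hx (fun y hy z hz ↦ ?_) fun y z hy hz ↦ ?_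
    · rw [← mul_assoc]
      exact Submodule.mul_mem_mul (hl a y hy) hz
    · rw [mul_add]
      exact add_mem hy hz
  have hmul {x y : A} (hx : x ∈ I) (hy : y ∈ I ^ k) : x * y ∈ I ^ (k + 1) := by
    rw [pow_succ']
    exact Submodule.mul_mem_mul hx hy
  let c (b : B) : B →ₗ[K] A := s ∘ₗ LinearMap.mulRight K b - LinearMap.mulRight K (s b) ∘ₗ s
  have hc (a b : B) : c b a = s (a * b) - s a * s b := rfl
  have hck (a b : B) : c b a ∈ I ^ k := hs a b
  let h : B →ₗ[K] A :=
    { toFun := fun b ↦ LinearMap.mul' K A (TensorProduct.map s (c b) e)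
      map_add' := fun a b ↦ by
        have : c (a + b) = c a + c b := by
          ext; simp [hc, mul_add]; abel
        rw [this, TensorProduct.map_add_right, LinearMap.add_apply, map_add]
      map_smul' := fun r b ↦ by
        have : c (r • b) = r • c b := by
          ext; simp [hc, smul_sub]
        rw [this, TensorProduct.map_smul_right, LinearMap.smul_apply, map_smul, RingHom.id_apply] }
  obtain ⟨m, x, y, hxy⟩ := TensorProduct.exists_sum_tmul_eq e
  have hh (b : B) : h b = ∑ i, s (x i) * c b (y i) := by
    change LinearMap.mul' K A (TensorProduct.map s (c b) e) = _
    simp [hxy]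
  have hone : ∑ i, x i * y i = 1 := by
    simpa [hxy] using he.1
  have hcomm (a b : B) : ∑ i, s (a * x i) * c b (y i) = ∑ i, s (x i) * c b (y i * a) := by
    have h1 := congrArg (fun t ↦ LinearMap.mul' K A (TensorProduct.map s (c b) t)) (he.2 a)
    simpa [hxy] using h1
  have hhk (b : B) : h b ∈ I ^ k := by
    rw [hh]
    exact sum_mem fun i _ ↦ hlk _ _ (hck _ _)
  refine ⟨s + h, fun b ↦ by simpa using hle (hhk b), fun a b ↦ ?_⟩
  have h1 : ∑ i, s (x i) * s (y i) = s 1 - ∑ i, c (y i) (x i) := by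
    simp only [hc, Finset.sum_sub_distrib, ← hone, map_sum, sub_sub_cancel]
  have h2 : s a * h b = (∑ i, s (x i) * s (y i)) * c b a + h (a * b) - h a * s b
      - ∑ i, c (x i) a * c b (y i) := by
    have h3 : s a * h b = ∑ i, s (a * x i) * c b (y i) - ∑ i, c (x i) a * c b (y i) := by
      rw [hh, ← Finset.sum_sub_distrib, Finset.mul_sum]
      refine Finset.sum_congr rfl fun i _ ↦ ?_
      rw [hc a (x i)]
      noncomm_ring
    have h6 : ∑ i, s (x i) * c b (y i * a) =
        (∑ i, s (x i) * s (y i)) * c b a + h (a * b) - h a * s b := by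
      rw [hh (a * b), hh a, Finset.sum_mul, Finset.sum_mul, ← Finset.sum_add_distrib,
        ← Finset.sum_sub_distrib]
      refine Finset.sum_congr rfl fun i _ ↦ ?_
      simp only [hc, mul_assoc]
      noncomm_ring
    rw [h3, hcomm, h6]
  have h4 : (s + h) (a * b) - (s + h) a * (s + h) b = (1 - s 1) * c b a
      + (∑ i, c (y i) (x i)) * c b a + ∑ i, c (x i) a * c b (y i) - h a * h b := by
    have h5 : (s + h) (a * b) - (s + h) a * (s + h) b =
        c b a + h (a * b) - s a * h b - h a * s b - h a * h b := by
      simp only [LinearMap.add_apply, hc]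
      noncomm_ring
    rw [h5, h2, h1]
    noncomm_ring
  rw [h4]
  exact sub_mem (add_mem (add_mem (hmul hs1 (hck _ _))
    (hmul (sum_mem fun i _ ↦ hle (hck _ _)) (hck _ _)))
    (sum_mem fun i _ ↦ hmul (hle (hck _ _)) (hck _ _))) (hmul (hle (hhk a)) (hhk b))

/-- **Wedderburn's principal theorem**: a surjection with nilpotent kernel onto an algebra with a
separability element splits. -/
theorem exists_algHom_section_of_isSeparabilityElement {K A B : Type*} [Field K] [Ring A]
    [Algebra K A] [Ring B] [Algebra K B] {e : B ⊗[K] B} (he : IsSeparabilityElement K e)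
    (π : A →ₐ[K] B) (hπ : Function.Surjective π) {n : ℕ}
    (hn : LinearMap.ker π.toLinearMap ^ n = ⊥) :
    ∃ s : B →ₐ[K] A, ∀ b, π (s b) = b := by
  set I := LinearMap.ker π.toLinearMap
  have hI {x : A} : x ∈ I ↔ π x = 0 := Iff.rfl
  have key (k : ℕ) : ∃ s : B →ₗ[K] A, (∀ b, π (s b) = b) ∧
      ∀ a b, s (a * b) - s a * s b ∈ I ^ (k + 1) := by
    induction k with
    | zero =>
      obtain ⟨s, hs⟩ := LinearMap.exists_rightInverse_of_surjective π.toLinearMap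
        (LinearMap.range_eq_top.mpr hπ)
      have hs (b : B) : π (s b) = b := LinearMap.congr_fun hs b
      exact ⟨s, hs, fun a b ↦ by simp [hI, hs]⟩
    | succ k ih =>
      obtain ⟨s, hs, hmul⟩ := ih
      obtain ⟨s', hs', hmul'⟩ := exists_linearMap_mul_sub_mem_pow_succ he I
        (fun a x hx ↦ by rw [hI] at *; simp [hx])
        k.succ_pos s (by simp [hI, hs]) hmul
      refine ⟨s', fun b ↦ ?_, hmul'⟩
      have h := hs' b
      rw [hI, map_sub, hs, sub_eq_zero] at h
      exact h
  obtain ⟨s, hs, hmul⟩ := key n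
  have hmul (a b : B) : s (a * b) = s a * s b := by
    have h := hmul a b
    rw [pow_succ, hn, Submodule.bot_mul, Submodule.mem_bot, sub_eq_zero] at h
    exact h
  have hone : s 1 = 1 := by
    have h1 : IsIdempotentElem (1 - s 1) :=
      IsIdempotentElem.one_sub (by rw [IsIdempotentElem, ← hmul, one_mul])
    have h2 : (1 - s 1) ^ (n + 1) ∈ I ^ (n + 1) :=
      Submodule.pow_mem_pow _ (by simp [hI, hs]) _
    rw [h1.pow_succ_eq, pow_succ, hn, Submodule.bot_mul, Submodule.mem_bot, sub_eq_zero] at h2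
    exact h2.symm
  exact ⟨AlgHom.ofLinearMap s hone hmul, hs⟩

lemma mkAlgHom_jacRel_eq_zero_iff {K A : Type*} [Field K] [Ring A] [Algebra K A] {x : A} :
    RingQuot.mkAlgHom K (jacRel A) x = 0 ↔ x ∈ Ideal.jacobson (⊥ : Ideal A) := by
  constructor
  · intro h
    have hlift : ∀ ⦃x y : A⦄, jacRel A x y → Ideal.Quotient.mk (Ideal.jacobson (⊥ : Ideal A)) x =
        Ideal.Quotient.mk (Ideal.jacobson (⊥ : Ideal A)) y :=
      fun x y hxy ↦ Ideal.Quotient.eq.mpr hxy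
    rw [← Ideal.Quotient.eq_zero_iff_mem,
      ← RingQuot.lift_mkRingHom_apply (Ideal.Quotient.mk _) hlift, ← RingQuot.mkAlgHom_coe K,
      RingHom.coe_coe, h, map_zero]
  · intro h
    rw [← map_zero (RingQuot.mkAlgHom K (jacRel A))]
    exact RingQuot.mkAlgHom_rel K (by simpa [jacRel] using h)

/-- A Wedderburn algebra has a splitting of the projection modulo its Jacobson radical. -/
theorem exists_algHom_section_jacQuot {K : Type u} [Field K] {A : Type v} [Ring A] [Algebra K A]
    (hnil : IsNilpotentSet (Ideal.jacobson (⊥ : Ideal A) : Set A))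
    (hsep : IsSeparableKAlgebra K (JacQuot A)) :
    ∃ s : JacQuot A →ₐ[K] A, ∀ b, RingQuot.mkAlgHom K (jacRel A) (s b) = b := by
  obtain ⟨e, he⟩ := hsep.exists_isSeparabilityElement
  obtain ⟨n, -, hn⟩ := hnil
  refine exists_algHom_section_of_isSeparabilityElement he (RingQuot.mkAlgHom K (jacRel A))
    (RingQuot.mkAlgHom_surjective K _) (n := n) ?_
  rw [Submodule.pow_eq_span_pow_set, Submodule.span_eq_bot]
  intro x hx
  obtain ⟨f, rfl⟩ := Set.mem_pow.mp hx
  refine hn _ (fun y hy ↦ ?_) (List.length_ofFn)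
  obtain ⟨i, rfl⟩ := (List.mem_ofFn' _ _).mp hy
  exact mkAlgHom_jacRel_eq_zero_iff.mp (f i).2

end Wedderburn

/-- A semisimple ring has a complete system of primitive orthogonal idempotents. -/
lemma IsSemisimpleRing.exists_primitive_orthogonalIdempotents (B : Type*) [Ring B]
    [IsSemisimpleRing B] :
    ∃ (ι : Type) (_ : Fintype ι) (e : ι → B), CompleteOrthogonalIdempotents e ∧ (∀ i, e i ≠ 0) ∧
      ∀ i b, e i * b * e i = 0 ∨ ∃ c, c * (e i * b * e i) = e i := by
  classical
  obtain ⟨n, D, d, _, hd, ⟨f⟩⟩ := IsSemisimpleRing.exists_ringEquiv_pi_matrix_divisionRing B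
  let E (p : Σ i, Fin (d i)) : Π i, Matrix (Fin (d i)) (Fin (d i)) (D i) :=
    Pi.single p.1 (Matrix.single p.2 p.2 1)
  have hE (p : Σ i, Fin (d i)) (b : Π i, Matrix (Fin (d i)) (Fin (d i)) (D i)) :
      E p * b * E p = Pi.single p.1 (Matrix.single p.2 p.2 (b p.1 p.2 p.2)) := by
    simp only [E]
    rw [← Pi.single_mul_left, ← Pi.single_mul, Matrix.single_mul_mul_single, one_mul, mul_one]
  have hcomplete : CompleteOrthogonalIdempotents E := by
    refine ⟨⟨fun p ↦ ?_, fun p q hpq ↦ ?_⟩, ?_⟩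
    · simp [E, IsIdempotentElem, ← Pi.single_mul]
    · obtain ⟨i, j⟩ := p
      obtain ⟨i', j'⟩ := q
      by_cases hi : i = i'
      · subst hi
        have hj : j ≠ j' := fun h ↦ hpq (by rw [h])
        simp [E, ← Pi.single_mul, hj]
      · ext k : 1
        by_cases hk : k = i
        · subst hk
          simp [E, hi]
        · simp [E, hk]
    · rw [Fintype.sum_sigma, ← Finset.univ_sum_single (1 : Π i, Matrix (Fin (d i)) (Fin (d i)) (D i))]
      refine Finset.sum_congr rfl fun i _ ↦ ?_
      rw [Pi.one_apply, ← Matrix.sum_single_one]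
      exact (map_sum (AddMonoidHom.single (fun i ↦ Matrix (Fin (d i)) (Fin (d i)) (D i)) i) _ _).symm
  refine ⟨_, inferInstance, f.symm ∘ E, hcomplete.map f.symm.toRingHom, fun p ↦ ?_, fun p b ↦ ?_⟩
  · have : Matrix.single p.2 p.2 (1 : D p.1) ≠ 0 := fun h ↦ one_ne_zero (α := D p.1) <| by
      simpa using congr_fun₂ h p.2 p.2
    simpa [E] using this
  · obtain ⟨b, rfl⟩ := f.symm.surjective b
    simp only [Function.comp_apply, ← map_mul, hE]
    by_cases h : b p.1 p.2 p.2 = 0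
    · left
      simp [h]
    · right
      refine ⟨f.symm (Pi.single p.1 (Matrix.single p.2 p.2 (b p.1 p.2 p.2)⁻¹)), ?_⟩
      rw [← map_mul, ← Pi.single_mul, Matrix.single_mul_single_same, inv_mul_cancel₀ h]

section CategoryRadical

variable {C : Type*} [Category* C] [Preadditive C] {W X Y Z : C}

lemma isIso_id_sub_comp_swap {f : X ⟶ Y} {g : Y ⟶ X} (h : IsIso (𝟙 X - f ≫ g)) :
    IsIso (𝟙 Y - g ≫ f) := by
  obtain ⟨u, hu₁, hu₂⟩ := h
  simp only [Preadditive.sub_comp, Preadditive.comp_sub, Category.id_comp, Category.comp_id,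
    Category.assoc] at hu₁ hu₂
  refine ⟨𝟙 Y + g ≫ u ≫ f, ?_, ?_⟩
  · have h := congrArg (fun t ↦ g ≫ t ≫ f) hu₁
    simp only [Preadditive.sub_comp, Preadditive.comp_sub, Preadditive.comp_add, Category.id_comp,
      Category.comp_id, Category.assoc] at h ⊢
    rw [← sub_eq_zero] at h ⊢
    rw [← h]
    abel
  · have h := congrArg (fun t ↦ g ≫ t ≫ f) hu₂
    simp only [Preadditive.sub_comp, Preadditive.comp_sub, Preadditive.add_comp, Category.id_comp,
      Category.comp_id, Category.assoc] at h ⊢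
    rw [← sub_eq_zero] at h ⊢
    rw [← h]
    abel

lemma comp_mem_catRadical {f : X ⟶ Y} (hf : f ∈ catRadical X Y) (h : Y ⟶ Z) :
    f ≫ h ∈ catRadical X Z := fun g ↦ by
  rw [Category.assoc]
  exact hf (h ≫ g)

lemma mem_catRadical_comp (h : W ⟶ X) {f : X ⟶ Y} (hf : f ∈ catRadical X Y) :
    h ≫ f ∈ catRadical W Y := fun g ↦ by
  rw [Category.assoc]
  refine isIso_id_sub_comp_swap ?_
  rw [Category.assoc]
  exact hf (g ≫ h)

variable (X Y) in
/-- The radical of a preadditive category, as a family of additive subgroups. -/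
def catRadicalAddSubgroup : AddSubgroup (X ⟶ Y) where
  carrier := catRadical X Y
  zero_mem' g := by
    rw [Limits.zero_comp, sub_zero]
    infer_instance
  neg_mem' {f} hf g := by
    simpa using hf (-g)
  add_mem' {f f'} hf hf' g := by
    have := hf g
    have := mem_catRadical_comp (inv (𝟙 X - f ≫ g)) hf' g
    have h : 𝟙 X - (f + f') ≫ g =
        (𝟙 X - f ≫ g) ≫ (𝟙 X - (inv (𝟙 X - f ≫ g) ≫ f') ≫ g) := by
      rw [Preadditive.comp_sub, Category.assoc, IsIso.hom_inv_id_assoc, Category.comp_id,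
        Preadditive.add_comp, sub_sub]
    rw [h]
    infer_instance

lemma mem_catRadicalAddSubgroup {f : X ⟶ Y} :
    f ∈ catRadicalAddSubgroup X Y ↔ f ∈ catRadical X Y := Iff.rfl

lemma neg_mem_catRadical {f : X ⟶ Y} (hf : f ∈ catRadical X Y) : -f ∈ catRadical X Y :=
  (catRadicalAddSubgroup X Y).neg_mem hf

lemma eq_zero_of_mem_catRadical_of_idem {p : X ⟶ X} (hp : p ∈ catRadical X X) (h : p ≫ p = p) :
    p = 0 := by
  have := hp p
  rw [h] at this
  rw [← cancel_epi (𝟙 X - p), Preadditive.sub_comp, h, Category.id_comp, sub_self,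
    Limits.comp_zero]

lemma mem_catRadical_of_idem_comp {e : X ⟶ X} {h : X ⟶ Y}
    (he : e ≫ h = h) (H : ∀ g : Y ⟶ X, h ≫ g ≫ e ∈ catRadical X X) : h ∈ catRadical X Y := by
  intro g
  rw [← he, Category.assoc]
  refine isIso_id_sub_comp_swap ?_
  simpa using H g (𝟙 X)

lemma mem_jacobson_bot_iff_mem_catRadical {x : End X} :
    x ∈ Ideal.jacobson (⊥ : Ideal (End X)) ↔ (x : X ⟶ X) ∈ catRadical X X := by
  simp only [Ideal.mem_jacobson_iff, Ideal.mem_bot]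
  constructor
  · intro h g
    obtain ⟨z, hz⟩ := h (-(show End X from g))
    obtain ⟨w, hw⟩ := h (z * (show End X from g))
    have hz' : z * (1 - (show End X from g) * x) = 1 := by
      rw [← sub_eq_zero, ← hz]
      noncomm_ring
    have hzeq : z = 1 + z * (show End X from g) * x := by
      rw [← hz', mul_sub, mul_one, mul_assoc, sub_add_cancel]
    have hw' : w * z = 1 := by
      rw [hzeq, ← sub_eq_zero, ← hw]
      noncomm_ring
    have hu : IsUnit z := by
      have : w = 1 - (show End X from g) * x := left_inv_eq_right_inv hw' hz'
      exact ⟨⟨z, _, hz', this ▸ hw'⟩, rfl⟩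
    have hu' : IsUnit (1 - (show End X from g) * x) := by
      obtain ⟨z, rfl⟩ := hu
      rw [← Units.inv_eq_of_mul_eq_one_right hz']
      exact z⁻¹.isUnit
    exact (isUnit_iff_isIso _).mp hu'
  · intro h y
    have hu : IsUnit (1 - (-y) * x : End X) := (isUnit_iff_isIso _).mpr (h (-y : End X))
    obtain ⟨u, hu⟩ := hu
    refine ⟨↑u⁻¹, ?_⟩
    have := u.inv_mul
    rw [hu] at this
    rw [← this]
    noncomm_ring

end CategoryRadical

section Splitting

/-- A multiplicative `K`-linear splitting of `End X` modulo the radical, together with a complete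
system of primitive orthogonal idempotents in its image. -/
structure PrimitiveSplitting (K : Type*) [Field K] {C : Type*} [Category* C] [Preadditive C]
    [CategoryTheory.Linear K C] (X : C) where
  /-- the splitting -/
  s : (X ⟶ X) →ₗ[K] (X ⟶ X)
  s_comp (f g : X ⟶ X) : s (f ≫ g) = s f ≫ s g
  s_id : s (𝟙 X) = 𝟙 X
  s_sub_mem (f : X ⟶ X) : s f - f ∈ catRadical X X
  s_eq_zero {f : X ⟶ X} (hf : f ∈ catRadical X X) : s f = 0
  /-- the index type of the idempotents -/
  ι : Type
  [fintype : Fintype ι]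
  /-- the idempotents -/
  e : ι → (X ⟶ X)
  s_e (i : ι) : s (e i) = e i
  e_comp_e (i : ι) : e i ≫ e i = e i
  e_comp_e_of_ne {i j : ι} (h : i ≠ j) : e i ≫ e j = 0
  sum_e : ∑ i, e i = 𝟙 X
  e_ne_zero (i : ι) : e i ≠ 0
  primitive (i : ι) (x : X ⟶ X) :
    s (e i ≫ x ≫ e i) = 0 ∨ ∃ c, s (e i ≫ x ≫ e i ≫ c) = e i

attribute [instance] PrimitiveSplitting.fintype

theorem IsWedderburnCat.nonempty_primitiveSplitting {K : Type u} [Field K] {C : Type v}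
    [SmallCategory C] [Preadditive C] [CategoryTheory.Linear K C] (hW : IsWedderburnCat K C)
    (X : C) : Nonempty (PrimitiveSplitting K X) := by
  obtain ⟨hnil, hsep⟩ := hW X
  obtain ⟨s, hs⟩ := exists_algHom_section_jacQuot hnil hsep
  have := hsep.isSemisimpleRing
  obtain ⟨ι, _, e, he, he0, hprim⟩ :=
    IsSemisimpleRing.exists_primitive_orthogonalIdempotents (JacQuot (End X))
  let π := RingQuot.mkAlgHom K (jacRel (End X))
  have hinj : Function.Injective s := Function.LeftInverse.injective hs
  exact ⟨{
    s := (s.comp π).toLinearMap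
    s_comp := fun (f g : End X) ↦ map_mul (s.comp π) g f
    s_id := map_one (s.comp π)
    s_sub_mem := fun f ↦ by
      rw [← mem_jacobson_bot_iff_mem_catRadical, ← mkAlgHom_jacRel_eq_zero_iff (K := K)]
      refine (map_sub _ _ _).trans (sub_eq_zero.mpr (hs _))
    s_eq_zero := fun {f} hf ↦ by
      rw [← mem_jacobson_bot_iff_mem_catRadical, ← mkAlgHom_jacRel_eq_zero_iff (K := K)] at hf
      exact (congrArg s hf).trans (map_zero s)
    ι := ι
    e := fun i ↦ s (e i)
    s_e := fun i ↦ congrArg s (hs _)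
    e_comp_e := fun i ↦ (map_mul s _ _).symm.trans (congrArg s (he.idem i))
    e_comp_e_of_ne := fun {i j} h ↦ ((map_mul s _ _).symm.trans
      (congrArg s (he.ortho h.symm))).trans (map_zero s)
    sum_e := (map_sum s _ _).symm.trans ((congrArg s he.complete).trans (map_one s))
    e_ne_zero := fun i h ↦ he0 i (hinj (h.trans (map_zero s).symm))
    primitive := fun i (x : End X) ↦ by
      have hπ : π (s (e i) * x * s (e i)) = e i * π x * e i := by
        rw [map_mul, map_mul, hs]
      refine (hprim i (π x)).imp (fun h ↦ ?_) fun ⟨c, hc⟩ ↦ ⟨s c, ?_⟩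
      · exact (congrArg s (hπ.trans h)).trans (map_zero s)
      · have : π (s c * (s (e i) * x * s (e i))) = e i := by
          rw [map_mul, hπ, hs, hc]
        refine Eq.trans (congrArg (s.comp π) ?_) (congrArg s this)
        simp only [End.mul_def, Category.assoc] }⟩

universe w

variable {C : Type w} [Category* C]

/-- Idempotents `e : X ⟶ X` and `e' : Y ⟶ Y` have isomorphic images. -/
def IdemEquiv {X Y : C} (e : X ⟶ X) (e' : Y ⟶ Y) : Prop :=
  ∃ (a : X ⟶ Y) (b : Y ⟶ X),
    e ≫ a = a ∧ a ≫ e' = a ∧ e' ≫ b = b ∧ b ≫ e = b ∧ a ≫ b = e ∧ b ≫ a = e'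

lemma IdemEquiv.symm {X Y : C} {e : X ⟶ X} {e' : Y ⟶ Y} (h : IdemEquiv e e') :
    IdemEquiv e' e := by
  obtain ⟨a, b, h₁, h₂, h₃, h₄, h₅, h₆⟩ := h
  exact ⟨b, a, h₃, h₄, h₁, h₂, h₆, h₅⟩

lemma IdemEquiv.trans {X Y Z : C} {e : X ⟶ X} {e' : Y ⟶ Y} {e'' : Z ⟶ Z}
    (h : IdemEquiv e e') (h' : IdemEquiv e' e'') : IdemEquiv e e'' := by
  obtain ⟨a, b, h₁, h₂, h₃, h₄, h₅, h₆⟩ := h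
  obtain ⟨a', b', h₁', h₂', h₃', h₄', h₅', h₆'⟩ := h'
  refine ⟨a ≫ a', b' ≫ b, ?_, ?_, ?_, ?_, ?_, ?_⟩
  · rw [reassoc_of% h₁]
  · rw [Category.assoc, h₂']
  · rw [reassoc_of% h₃']
  · rw [Category.assoc, h₄]
  · rw [Category.assoc, reassoc_of% h₅', h₃, h₅]
  · rw [Category.assoc, reassoc_of% h₆, h₁', h₆']

variable {K : Type*} [Field K] [Preadditive C] [CategoryTheory.Linear K C]

namespace PrimitiveSplitting

lemma mem_catRadical_of_s_eq_zero {X : C} (D : PrimitiveSplitting K X) {f : X ⟶ X}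
    (hf : D.s f = 0) : f ∈ catRadical X X := by
  simpa [hf] using neg_mem_catRadical (D.s_sub_mem f)

lemma s_e_comp_e_eq_zero {X Y : C} (D : PrimitiveSplitting K X) (D' : PrimitiveSplitting K Y)
    {i : D.ι} {j : D'.ι} (h : ¬ IdemEquiv (D.e i) (D'.e j)) (x : X ⟶ Y) (y : Y ⟶ X) :
    D.s (D.e i ≫ x ≫ D'.e j ≫ y ≫ D.e i) = 0 := by
  by_contra h0
  have hi := D.e_comp_e i
  have hj := D'.e_comp_e j
  obtain ⟨c, hc⟩ := (D.primitive i (x ≫ D'.e j ≫ y)).resolve_left (by simpa using h0)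
  let q := D.e i ≫ x ≫ D'.e j ≫ y ≫ D.e i ≫ c ≫ D.e i
  have hq : D.s q = D.e i := by
    have : q = (D.e i ≫ (x ≫ D'.e j ≫ y) ≫ D.e i ≫ c) ≫ D.e i := by simp [q]
    rw [this, D.s_comp, hc, D.s_e, hi]
  have hu : IsIso (𝟙 X + q - D.e i) := by
    have := D.s_sub_mem q (𝟙 X)
    rwa [hq, Category.comp_id, sub_sub_eq_add_sub] at this
  have heq : D.e i ≫ (𝟙 X + q - D.e i) = q := by
    simp [q, reassoc_of% hi, hi]
  obtain ⟨u, hu⟩ : ∃ u, q ≫ u = D.e i :=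
    ⟨inv (𝟙 X + q - D.e i), by rw [IsIso.comp_inv_eq, heq]⟩
  let a := D.e i ≫ x ≫ D'.e j
  let b := D'.e j ≫ y ≫ D.e i ≫ c ≫ D.e i ≫ u ≫ D.e i
  have hab : a ≫ b = D.e i := by
    have : a ≫ b = (q ≫ u) ≫ D.e i := by simp [a, b, q, reassoc_of% hj]
    rw [this, hu, hi]
  have ha₁ : D.e i ≫ a = a := by simp [a, reassoc_of% hi]
  have ha₂ : a ≫ D'.e j = a := by simp [a, hj]
  have hb₁ : D'.e j ≫ b = b := by simp [b, reassoc_of% hj]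
  have hb₂ : b ≫ D.e i = b := by simp [b, hi]
  clear_value a b
  refine h ⟨a, b, ha₁, ha₂, hb₁, hb₂, hab, ?_⟩
  have hp : (b ≫ a) ≫ b ≫ a = b ≫ a := by rw [Category.assoc, reassoc_of% hab, ha₁]
  have hepe : D'.e j ≫ (b ≫ a) ≫ D'.e j = b ≫ a := by
    rw [Category.assoc, ha₂, reassoc_of% hb₁]
  have hpe : (b ≫ a) ≫ D'.e j = b ≫ a := by rw [Category.assoc, ha₂]
  have hep : D'.e j ≫ (b ≫ a) = b ≫ a := by rw [reassoc_of% hb₁]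
  rcases D'.primitive j (b ≫ a) with hz | ⟨c', hc'⟩
  · rw [hepe] at hz
    have hba : b ≫ a = 0 :=
      eq_zero_of_mem_catRadical_of_idem (D'.mem_catRadical_of_s_eq_zero hz) hp
    refine absurd ?_ (D.e_ne_zero i)
    rw [← hi, ← hab, Category.assoc, reassoc_of% hba, Limits.zero_comp, Limits.comp_zero]
  · have hbac : D'.s ((b ≫ a) ≫ c') = D'.e j := by
      simpa only [Category.assoc, reassoc_of% hb₁, reassoc_of% ha₂] using hc'
    have hs : D'.s (b ≫ a) = D'.e j := by
      rw [← hpe, D'.s_comp, D'.s_e, ← hbac, ← D'.s_comp, ← Category.assoc, hp]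
    have hz : D'.s (D'.e j - b ≫ a) = 0 := by rw [map_sub, hs, D'.s_e, sub_self]
    have := eq_zero_of_mem_catRadical_of_idem (D'.mem_catRadical_of_s_eq_zero hz) (by
      rw [Preadditive.sub_comp, Preadditive.comp_sub, Preadditive.comp_sub, hp, hpe, hep, hj]
      abel)
    exact (sub_eq_zero.mp this).symm

lemma e_comp_e_mem_catRadical {X Y : C} (D : PrimitiveSplitting K X) (D' : PrimitiveSplitting K Y)
    {i : D.ι} {j : D'.ι} (h : ¬ IdemEquiv (D.e i) (D'.e j)) (x : X ⟶ Y) :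
    D.e i ≫ x ≫ D'.e j ∈ catRadical X Y := by
  refine mem_catRadical_of_idem_comp (e := D.e i) ?_ fun g ↦ ?_
  · rw [← Category.assoc, D.e_comp_e]
  · refine D.mem_catRadical_of_s_eq_zero ?_
    simpa using D.s_e_comp_e_eq_zero D' h x g

/-- A choice of representatives `rep c` of the isomorphism classes `c` of images of the primitive
idempotents, with compatible isomorphisms `out c p`, `into c p` between the image of a primitive
idempotent `p` and the representative of its class `cls p`, extended by zero to the other
classes. -/
structure Representatives (D : ∀ X : C, PrimitiveSplitting K X) where
  /-- the type of isomorphism classes -/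
  Q : Type w
  /-- the class of an idempotent -/
  cls : (Σ X, (D X).ι) → Q
  /-- the representative of a class -/
  rep : Q → Σ X, (D X).ι
  /-- the morphism to the representative -/
  out (c : Q) (X : C) (i : (D X).ι) : X ⟶ (rep c).1
  /-- the morphism from the representative -/
  into (c : Q) (X : C) (i : (D X).ι) : (rep c).1 ⟶ X
  out_eq_zero {c : Q} {X : C} {i : (D X).ι} (h : c ≠ cls ⟨X, i⟩) : out c X i = 0
  into_eq_zero {c : Q} {X : C} {i : (D X).ι} (h : c ≠ cls ⟨X, i⟩) : into c X i = 0
  e_out (c : Q) (X : C) (i : (D X).ι) : (D X).e i ≫ out c X i = out c X i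
  out_e (c : Q) (X : C) (i : (D X).ι) : out c X i ≫ (D _).e (rep c).2 = out c X i
  e_into (c : Q) (X : C) (i : (D X).ι) : (D _).e (rep c).2 ≫ into c X i = into c X i
  into_e (c : Q) (X : C) (i : (D X).ι) : into c X i ≫ (D X).e i = into c X i
  out_into (X : C) (i : (D X).ι) : out (cls ⟨X, i⟩) X i ≫ into (cls ⟨X, i⟩) X i = (D X).e i
  into_out {c : Q} {X : C} {i : (D X).ι} (h : c = cls ⟨X, i⟩) :
    into c X i ≫ out c X i = (D _).e (rep c).2
  not_idemEquiv {X Y : C} {i : (D X).ι} {j : (D Y).ι} (h : cls ⟨X, i⟩ ≠ cls ⟨Y, j⟩) :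
    ¬ IdemEquiv ((D X).e i) ((D Y).e j)
  cls_rep (c : Q) : cls (rep c) = c

theorem nonempty_representatives (D : ∀ X : C, PrimitiveSplitting K X) :
    Nonempty (Representatives D) := by
  classical
  let S : Setoid (Σ X, (D X).ι) :=
    { r := fun p q ↦ IdemEquiv ((D p.1).e p.2) ((D q.1).e q.2)
      iseqv := ⟨fun p ↦ ⟨_, _, (D p.1).e_comp_e _, (D p.1).e_comp_e _, (D p.1).e_comp_e _,
        (D p.1).e_comp_e _, (D p.1).e_comp_e _, (D p.1).e_comp_e _⟩, .symm, .trans⟩ }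
  have key (c : Quotient S) (X : C) (i : (D X).ι) :
      ∃ (a : X ⟶ c.out.1) (b : c.out.1 ⟶ X),
        (c ≠ ⟦⟨X, i⟩⟧ → a = 0 ∧ b = 0) ∧ (D X).e i ≫ a = a ∧ a ≫ (D _).e c.out.2 = a ∧
        (D _).e c.out.2 ≫ b = b ∧ b ≫ (D X).e i = b ∧
        (c = ⟦⟨X, i⟩⟧ → a ≫ b = (D X).e i ∧ b ≫ a = (D _).e c.out.2) := by
    by_cases h : c = ⟦⟨X, i⟩⟧
    · have h' : IdemEquiv ((D X).e i) ((D _).e c.out.2) :=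
        (Quotient.exact (c.out_eq.trans h) : IdemEquiv _ _).symm
      obtain ⟨a, b, h₁, h₂, h₃, h₄, h₅, h₆⟩ := h'
      exact ⟨a, b, fun h' ↦ absurd h h', h₁, h₂, h₃, h₄, fun _ ↦ ⟨h₅, h₆⟩⟩
    · exact ⟨0, 0, by simp, by simp, by simp, by simp, by simp, fun h' ↦ absurd h' h⟩
  choose out into h₀ h₁ h₂ h₃ h₄ h₅ using key
  exact ⟨{
    Q := Quotient S
    cls := Quotient.mk S
    rep := Quotient.out
    out := out
    into := into
    out_eq_zero := fun h ↦ (h₀ _ _ _ h).1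
    into_eq_zero := fun h ↦ (h₀ _ _ _ h).2
    e_out := h₁
    out_e := h₂
    e_into := h₃
    into_e := h₄
    out_into := fun X i ↦ (h₅ _ _ _ rfl).1
    into_out := fun h ↦ (h₅ _ _ _ h).2
    not_idemEquiv := fun h h' ↦ h (Quotient.sound h')
    cls_rep := Quotient.out_eq }⟩

namespace Representatives

variable {D : ∀ X : C, PrimitiveSplitting K X} (R : Representatives D)

/-- The component of the section on the class `c` and the idempotents `i` and `j`. -/
def component (c : R.Q) {X Y : C} (i : (D X).ι) (j : (D Y).ι) : (X ⟶ Y) →ₗ[K] (X ⟶ Y) where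
  toFun f := R.out c X i ≫ (D _).s (R.into c X i ≫ f ≫ R.out c Y j) ≫ R.into c Y j
  map_add' f g := by simp
  map_smul' r f := by simp

/-- The functorial section attached to splittings of the endomorphism algebras and
representatives of their primitive idempotents. -/
def sectionMap (X Y : C) : (X ⟶ Y) →ₗ[K] (X ⟶ Y) :=
  ∑ i, ∑ j, R.component (R.cls ⟨X, i⟩) i j

lemma sectionMap_apply {X Y : C} (f : X ⟶ Y) :
    R.sectionMap X Y f = ∑ i, ∑ j, R.out (R.cls ⟨X, i⟩) X i ≫
      (D _).s (R.into (R.cls ⟨X, i⟩) X i ≫ f ≫ R.out (R.cls ⟨X, i⟩) Y j) ≫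
        R.into (R.cls ⟨X, i⟩) Y j := by
  simp [sectionMap, component]

lemma into_out_of_ne (c c' : R.Q) {X : C} {i j : (D X).ι} (h : i ≠ j) :
    R.into c X i ≫ R.out c' X j = 0 := by
  rw [← R.into_e, ← R.e_out, Category.assoc, reassoc_of% (D X).e_comp_e_of_ne h,
    Limits.zero_comp, Limits.comp_zero]

lemma sectionMap_id (X : C) : R.sectionMap X X (𝟙 X) = 𝟙 X := by
  classical
  rw [sectionMap_apply, ← (D X).sum_e]
  refine Finset.sum_congr rfl fun i _ ↦ ?_
  rw [Finset.sum_eq_single i]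
  · rw [(D X).sum_e, Category.id_comp, R.into_out rfl, s_e, R.e_into, R.out_into]
  · intro j _ hj
    rw [(D X).sum_e, Category.id_comp, R.into_out_of_ne _ _ hj.symm]
    simp
  · simp

lemma sectionMap_eq_zero {X Y : C} {f : X ⟶ Y} (hf : f ∈ catRadical X Y) :
    R.sectionMap X Y f = 0 := by
  rw [sectionMap_apply]
  refine Finset.sum_eq_zero fun i _ ↦ Finset.sum_eq_zero fun j _ ↦ ?_
  rw [(D _).s_eq_zero (mem_catRadical_comp _ (comp_mem_catRadical hf _))]
  simp

lemma sum_e_comp_e {X Y : C} (f : X ⟶ Y) : ∑ i, ∑ j, (D X).e i ≫ f ≫ (D Y).e j = f := by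
  simp_rw [← Preadditive.comp_sum, sum_e, Category.comp_id, ← Preadditive.sum_comp, sum_e,
    Category.id_comp]

lemma sectionMap_sub_mem {X Y : C} (f : X ⟶ Y) : R.sectionMap X Y f - f ∈ catRadical X Y := by
  rw [sectionMap_apply]
  nth_rw 2 [← sum_e_comp_e (D := D) f]
  rw [← mem_catRadicalAddSubgroup, ← Finset.sum_sub_distrib]
  refine sum_mem fun i _ ↦ ?_
  rw [← Finset.sum_sub_distrib]
  refine sum_mem fun j _ ↦ ?_
  rw [mem_catRadicalAddSubgroup]
  by_cases h : R.cls ⟨X, i⟩ = R.cls ⟨Y, j⟩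
  · have h' : (D Y).e j = R.out (R.cls ⟨X, i⟩) Y j ≫ R.into (R.cls ⟨X, i⟩) Y j := by
      rw [h, R.out_into]
    rw [h', ← R.out_into X i]
    have := mem_catRadical_comp (R.out (R.cls ⟨X, i⟩) X i) (comp_mem_catRadical
      ((D _).s_sub_mem (R.into (R.cls ⟨X, i⟩) X i ≫ f ≫ R.out (R.cls ⟨X, i⟩) Y j))
      (R.into (R.cls ⟨X, i⟩) Y j))
    simpa only [Preadditive.sub_comp, Preadditive.comp_sub, Category.assoc] using this
  · rw [R.out_eq_zero h, R.into_eq_zero h]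
    simpa using neg_mem_catRadical ((D X).e_comp_e_mem_catRadical (D Y) (R.not_idemEquiv h) f)

lemma component_comp {c c' : R.Q} {X Y Z : C} (i : (D X).ι) {j : (D Y).ι} (k : (D Z).ι)
    (h : c' = R.cls ⟨Y, j⟩) (f : X ⟶ Y) (g : Y ⟶ Z) :
    R.component c i k (f ≫ (D Y).e j ≫ g) = R.component c i j f ≫ R.component c' j k g := by
  simp only [component, LinearMap.coe_mk, AddHom.coe_mk, Category.assoc]
  by_cases hc : c = c'
  · subst hc
    have he : (D Y).e j = R.out c Y j ≫ R.into c Y j := by rw [h, R.out_into]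
    have hs := (D _).s_comp (R.into c X i ≫ f ≫ R.out c Y j) (R.into c Y j ≫ g ≫ R.out c Z k)
    have ht := (D _).s_comp (R.into c X i ≫ f ≫ R.out c Y j) ((D _).e (R.rep c).2)
    simp only [Category.assoc, s_e, R.out_e] at hs ht
    rw [he, reassoc_of% R.into_out h, ← reassoc_of% ht, Category.assoc, hs, Category.assoc]
  · rw [h] at hc
    have h0 := (D _).s_e_comp_e_eq_zero (D Y) (i := (R.rep c).2) (j := j)
      (R.not_idemEquiv (by rwa [Sigma.eta, R.cls_rep])) (R.into c X i ≫ f) (g ≫ R.out c Z k)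
    simp only [Category.assoc, R.out_e, reassoc_of% R.e_into] at h0
    rw [h0, R.into_eq_zero hc]
    simp

lemma component_comp_of_ne (c c' : R.Q) {X Y Z : C} (i : (D X).ι) {j j' : (D Y).ι} (k : (D Z).ι)
    (h : j ≠ j') (f : X ⟶ Y) (g : Y ⟶ Z) :
    R.component c i j f ≫ R.component c' j' k g = 0 := by
  simp only [component, LinearMap.coe_mk, AddHom.coe_mk, Category.assoc]
  rw [reassoc_of% R.into_out_of_ne c c' h]
  simp

lemma sectionMap_comp {X Y Z : C} (f : X ⟶ Y) (g : Y ⟶ Z) :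
    R.sectionMap X Z (f ≫ g) = R.sectionMap X Y f ≫ R.sectionMap Y Z g := by
  have h : f ≫ g = ∑ j, f ≫ (D Y).e j ≫ g := by
    rw [← Preadditive.comp_sum, ← Preadditive.sum_comp, sum_e, Category.id_comp]
  simp only [sectionMap, LinearMap.sum_apply, Preadditive.sum_comp]
  refine Finset.sum_congr rfl fun i _ ↦ ?_
  simp only [Preadditive.comp_sum]
  simp only [h, map_sum]
  rw [Finset.sum_comm]
  refine Finset.sum_congr rfl fun j _ ↦ ?_
  rw [Finset.sum_eq_single j]
  · exact Finset.sum_congr rfl fun k _ ↦ R.component_comp i k rfl f g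
  · exact fun j' _ hj ↦ Finset.sum_eq_zero fun k _ ↦ R.component_comp_of_ne _ _ i k hj.symm f g
  · simp

end Representatives

end PrimitiveSplitting

end Splitting

/-- **Wedderburn's theorem for categories.** If `C` is a small Wedderburn `K`-linear
category, then the projection of `C` onto its quotient by the radical admits a functorial
`K`-linear section. -/
theorem exists_functorial_section
    (K : Type u) [Field K] (C : Type v) [SmallCategory C] [Preadditive C]
    [CategoryTheory.Linear K C] [Limits.HasFiniteBiproducts C]
    (hW : IsWedderburnCat K C) :
    ∃ σ : ∀ X Y : C, (X ⟶ Y) →ₗ[K] (X ⟶ Y), IsFunctorialSection K σ := by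
  obtain ⟨R⟩ := PrimitiveSplitting.nonempty_representatives
    fun X ↦ (hW.nonempty_primitiveSplitting X).some
  refine ⟨R.sectionMap, fun X Y f ↦ R.sectionMap_sub_mem f, fun X Y f f' h ↦ ?_, R.sectionMap_id,
    fun X Y Z f g ↦ R.sectionMap_comp f g⟩
  rw [← sub_eq_zero, ← map_sub, R.sectionMap_eq_zero h]
end

section
/- Let K be a field, let A be a Wedderburn K-algebra (the Jacobson radical J(A) is nilpotent and A/J(A) is a separable K-algebra), and let B ⊆ A be a K-subalgebra which is a separable K-algebra. Then there exists a K-algebra homomorphism s : A/J(A) → A which is a section of the quotient map π : A → A/J(A) (i.e. π ∘ s = id) and which satisfies s(π(b)) = b for every b ∈ B. -/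
open TensorProduct

universe u v

/-- A `K`-algebra has a *separability element* if some `e` in `B ⊗[K] B` is mapped to `1` by
the multiplication and satisfies `b e = e b` for all `b`. -/
def HasSeparabilityElement (K : Type*) [Field K] (B : Type*) [Ring B] [Algebra K B] : Prop :=
  ∃ e : B ⊗[K] B, LinearMap.mul' K B e = 1 ∧
    ∀ b : B, (LinearMap.mulLeft K b).rTensor B e = (LinearMap.mulRight K b).lTensor B e

namespace HasSeparabilityElement

variable {K : Type*} [Field K] {B : Type*} [Ring B] [Algebra K B]

lemma exists_finset (h : HasSeparabilityElement K B) :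
    ∃ S : Finset (B × B), ∑ i ∈ S, i.1 * i.2 = 1 ∧
      ∀ (b : B) {M : Type*} [AddCommGroup M] [Module K M] (β : B →ₗ[K] B →ₗ[K] M),
        ∑ i ∈ S, β (b * i.1) i.2 = ∑ i ∈ S, β i.1 (i.2 * b) := by
  obtain ⟨e, he, hb⟩ := h
  obtain ⟨S, rfl⟩ := TensorProduct.exists_finset e
  refine ⟨S, by simpa using he, fun b M _ _ β ↦ ?_⟩
  simpa using congrArg (TensorProduct.lift β) (hb b)

lemma of_algEquiv {C : Type*} [Ring C] [Algebra K C] (φ : B ≃ₐ[K] C)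
    (h : HasSeparabilityElement K B) : HasSeparabilityElement K C := by
  obtain ⟨S, h1, h2⟩ := h.exists_finset
  refine ⟨∑ i ∈ S, φ i.1 ⊗ₜ φ i.2, by simpa using congrArg φ h1, fun c ↦ ?_⟩
  obtain ⟨b, rfl⟩ := φ.surjective c
  simpa using h2 b ((TensorProduct.mk K C C).compl₁₂ φ.toLinearMap φ.toLinearMap)

/-- Separability elements descend along field extensions. -/
lemma of_baseChange {L : Type*} [Field L] [Algebra K L]
    (h : HasSeparabilityElement L (L ⊗[K] B)) : HasSeparabilityElement K B := by
  obtain ⟨S, h1, h2⟩ := h.exists_finset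
  obtain ⟨l, hl⟩ := (Algebra.linearMap K L).exists_leftInverse_of_injective
    (LinearMap.ker_eq_bot.2 (algebraMap K L).injective)
  have hl1 : l 1 = 1 := by simpa using LinearMap.congr_fun hl 1
  let ψ : L ⊗[K] (B ⊗[K] B) →ₗ[K] B ⊗[K] B :=
    (TensorProduct.lid K (B ⊗[K] B)).toLinearMap ∘ₗ l.rTensor (B ⊗[K] B)
  let δ := (TensorProduct.AlgebraTensorModule.distribBaseChange K L B B).symm
  let β : L ⊗[K] B →ₗ[L] L ⊗[K] B →ₗ[L] L ⊗[K] (B ⊗[K] B) :=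
    (TensorProduct.mk L (L ⊗[K] B) (L ⊗[K] B)).compr₂ δ.toLinearMap
  have hβ (x y : L) (b c : B) : β (x ⊗ₜ b) (y ⊗ₜ c) = (x * y) ⊗ₜ (b ⊗ₜ c) :=
    TensorProduct.AlgebraTensorModule.distribBaseChange_symm_tmul ..
  have hmul (p q : L ⊗[K] B) : LinearMap.mul' K B (ψ (β p q)) =
      TensorProduct.lid K B (l.rTensor B (p * q)) := by
    induction p with
    | zero => simp
    | add p p' hp hp' => simp [hp, hp', add_mul]
    | tmul x b =>
      induction q with
      | zero => simp
      | add q q' hq hq' => simp only [map_add, hq, hq', mul_add]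
      | tmul y c => simp [hβ, ψ]
  have hleft (b : B) (p q : L ⊗[K] B) : (LinearMap.mulLeft K b).rTensor B (ψ (β p q)) =
      ψ (β ((1 ⊗ₜ b) * p) q) := by
    induction p with
    | zero => simp
    | add p p' hp hp' => simp only [map_add, LinearMap.add_apply, hp, hp', mul_add]
    | tmul x b =>
      induction q with
      | zero => simp
      | add q q' hq hq' => simp only [map_add, hq, hq']
      | tmul y c => simp [hβ, ψ]
  have hright (b : B) (p q : L ⊗[K] B) : (LinearMap.mulRight K b).lTensor B (ψ (β p q)) =
      ψ (β p (q * (1 ⊗ₜ b))) := by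
    induction p with
    | zero => simp
    | add p p' hp hp' => simp only [map_add, LinearMap.add_apply, hp, hp']
    | tmul x b =>
      induction q with
      | zero => simp
      | add q q' hq hq' => simp only [map_add, hq, hq', add_mul]
      | tmul y c => simp [hβ, ψ]
  refine ⟨ψ (∑ i ∈ S, β i.1 i.2), ?_, fun b ↦ ?_⟩
  · simp only [map_sum, hmul]
    simp only [← map_sum, h1, Algebra.TensorProduct.one_def]
    simp [hl1]
  · simp only [map_sum, hleft, hright]
    simp only [← map_sum]
    exact congrArg ψ (h2 (1 ⊗ₜ b) β)

lemma pi_matrix {n : ℕ} (d : Fin n → ℕ) (hd : ∀ i, NeZero (d i)) :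
    HasSeparabilityElement K (Π i, Matrix (Fin (d i)) (Fin (d i)) K) := by
  let P (j : Fin n) (r c : Fin (d j)) : Π i, Matrix (Fin (d i)) (Fin (d i)) K :=
    Pi.single j (Matrix.single r c 1)
  have hleft (b : Π i, Matrix (Fin (d i)) (Fin (d i)) K) (j : Fin n) (r c : Fin (d j)) :
      b * P j r c = ∑ k, b j k r • P j k c := by
    ext i s t
    rcases eq_or_ne i j with rfl | h
    · simp [P, Matrix.sum_apply, Matrix.mul_apply, Matrix.single_apply, ite_and]
    · simp [P, h, Matrix.sum_apply]
  have hright (b : Π i, Matrix (Fin (d i)) (Fin (d i)) K) (j : Fin n) (r c : Fin (d j)) :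
      P j r c * b = ∑ k, b j c k • P j r k := by
    ext i s t
    rcases eq_or_ne i j with rfl | h
    · simp [P, Matrix.sum_apply, Matrix.mul_apply, Matrix.single_apply, ite_and]
    · simp [P, h, Matrix.sum_apply]
  refine ⟨∑ j, ∑ i, P j i 0 ⊗ₜ P j 0 i, ?_, fun b ↦ ?_⟩
  · have (j : Fin n) : ∑ r, P j r 0 * P j 0 r = Pi.single j 1 := by
      have h (r : Fin (d j)) : P j r 0 * P j 0 r = Pi.single j (Matrix.single r r 1) := by
        simp [P, ← Pi.single_mul]
      simp only [h]
      ext i s t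
      rcases eq_or_ne i j with rfl | h
      · simp [Matrix.sum_apply, Matrix.single_apply, Matrix.one_apply, ite_and]
      · simp [h, Matrix.sum_apply]
    simp only [map_sum, LinearMap.mul'_apply, this]
    exact Finset.univ_sum_single (1 : Π i, Matrix (Fin (d i)) (Fin (d i)) K)
  · simp only [map_sum, LinearMap.rTensor_tmul, LinearMap.lTensor_tmul, LinearMap.mulLeft_apply,
      LinearMap.mulRight_apply, hleft, hright, TensorProduct.sum_tmul, TensorProduct.tmul_sum,
      TensorProduct.smul_tmul', TensorProduct.tmul_smul]
    exact Finset.sum_congr rfl fun j _ ↦ Finset.sum_comm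

end HasSeparabilityElement

/-- Amitsur: the inverses `(x - a)⁻¹` of a transcendental element of a division algebra are
linearly independent. -/
lemma linearIndependent_sub_inv_of_transcendental {F D : Type*} [Field F] [DivisionRing D]
    [Algebra F D] {x : D} (H : Transcendental F x) :
    LinearIndependent F fun a ↦ (x - algebraMap F D a)⁻¹ := by
  classical
  let φ := Polynomial.aeval (R := F) x
  have hφ (a : F) : φ (.X - .C a) = x - algebraMap F D a := by simp [φ]
  have hinj : Function.Injective φ := transcendental_iff_injective.1 H
  have hnz (a : F) : φ (.X - .C a) ≠ 0 := by
    rw [map_ne_zero_iff φ hinj]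
    exact Polynomial.X_sub_C_ne_zero a
  refine linearIndependent_iff'.2 fun s m hm i hi ↦ ?_
  let p (j : F) : Polynomial F := ∏ k ∈ s.erase j, (.X - .C k)
  have hp (j : F) (hj : j ∈ s) :
      φ (∏ k ∈ s, (.X - .C k)) * (x - algebraMap F D j)⁻¹ = φ (p j) := by
    rw [← Finset.prod_erase_mul s _ hj, map_mul, ← hφ, mul_inv_cancel_right₀ (hnz j)]
  have h0 : ∑ j ∈ s, m j • p j = 0 := by
    apply hinj
    replace hm := congrArg (φ (∏ k ∈ s, (.X - .C k)) * ·) hm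
    simp only [Finset.mul_sum, mul_smul_comm, mul_zero] at hm
    rw [map_zero, map_sum, ← hm]
    exact Finset.sum_congr rfl fun j hj ↦ by rw [hp j hj, map_smul]
  have h1 := congrArg (Polynomial.eval i) h0
  rw [Polynomial.eval_finsetSum, Finset.sum_eq_single_of_mem i hi] at h1
  · simp only [Polynomial.eval_smul, smul_eq_mul, Polynomial.eval_zero, mul_eq_zero] at h1
    refine h1.resolve_right ?_
    simp only [p, Polynomial.eval_prod, Finset.prod_ne_zero_iff]
    intro k hk
    simpa [sub_eq_zero] using (Finset.ne_of_mem_erase hk).symm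
  · intro j _ hji
    rw [Polynomial.eval_smul, Polynomial.eval_prod,
      Finset.prod_eq_zero (Finset.mem_erase_of_ne_of_mem hji.symm hi) (by simp), smul_zero]

/-- A division algebra over an algebraically closed field `F` whose dimension is smaller than
the cardinality of `F` is equal to `F`. -/
lemma algebraMap_bijective_of_rank_lt_card {F D : Type u} [Field F] [IsAlgClosed F]
    [DivisionRing D] [Algebra F D] (h : Module.rank F D < Cardinal.mk F) :
    Function.Bijective (algebraMap F D) := by
  have : Algebra.IsIntegral F D := by
    refine ⟨fun x ↦ ?_⟩
    by_contra hx
    rw [← isAlgebraic_iff_isIntegral] at hx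
    exact h.not_ge (linearIndependent_sub_inv_of_transcendental hx).cardinal_le_rank
  exact IsAlgClosed.algebraMap_bijective_of_isIntegral

lemma exists_isAlgClosed_card_lt (K B : Type u) [Field K] :
    ∃ (L : Type u) (_ : Field L) (_ : Algebra K L), IsAlgClosed L ∧
      Cardinal.mk B < Cardinal.mk L := by
  let F := FractionRing (MvPolynomial (Set B) K)
  refine ⟨AlgebraicClosure F, inferInstance, inferInstance, inferInstance, ?_⟩
  let g : Set B → AlgebraicClosure F := fun s ↦
    algebraMap F _ (algebraMap (MvPolynomial (Set B) K) F (MvPolynomial.X s))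
  have hg : Function.Injective g := (algebraMap F _).injective.comp
    ((IsFractionRing.injective (MvPolynomial (Set B) K) F).comp MvPolynomial.X_injective)
  refine (Cardinal.cantor _).trans_le ?_
  rw [← Cardinal.mk_set]
  exact Cardinal.mk_le_of_injective hg

/-- An absolutely semisimple algebra has a separability element. -/
lemma IsSeparableKAlgebra.hasSeparabilityElement {K B : Type u} [Field K] [Ring B] [Algebra K B]
    (h : IsSeparableKAlgebra K B) : HasSeparabilityElement K B := by
  obtain ⟨L, _, _, _, hL⟩ := exists_isAlgClosed_card_lt K B
  have := h L
  obtain ⟨n, D, d, _, _, hd, ⟨e⟩⟩ :=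
    IsSemisimpleRing.exists_algEquiv_pi_matrix_divisionRing L (L ⊗[K] B)
  have hD (i : Fin n) : Function.Bijective (algebraMap L (D i)) := by
    apply algebraMap_bijective_of_rank_lt_card
    let l : (L ⊗[K] B) →ₗ[L] D i := Matrix.entryLinearMap L (D i) 0 0 ∘ₗ
      .proj (φ := fun i ↦ Matrix (Fin (d i)) (Fin (d i)) (D i)) i ∘ₗ e.toLinearMap
    have hl : Function.Surjective l := by
      intro x
      exact ⟨e.symm (Pi.single i (Matrix.of fun _ _ ↦ x)), by simp [l]⟩
    calc Module.rank L (D i) ≤ Module.rank L (L ⊗[K] B) := l.rank_le_of_surjective hl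
      _ = Module.rank K B := by simp
      _ ≤ Cardinal.mk B := rank_le_card K B
      _ < Cardinal.mk L := hL
  exact .of_baseChange (L := L) <| .of_algEquiv (e.trans <| .piCongrRight fun i ↦ .mapMatrix <|
    .symm <| .ofBijective (Algebra.ofId L (D i)) (hD i)).symm (.pi_matrix d hd)

section Lifting

variable {K S A : Type*} [Field K] [Ring S] [Algebra K S] [Ring A] [Algebra K A]

/-- A unital linear map which is multiplicative modulo an ideal `I` can be corrected by a map
with values in `I` so that it becomes multiplicative modulo `I * I`. -/
lemma HasSeparabilityElement.exists_mul_mem_mul_self (hS : HasSeparabilityElement K S)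
    (σ : S →ₗ[K] A) (h1 : σ 1 = 1) (I : Ideal A) [I.IsTwoSided]
    (hI : ∀ a b, σ a * σ b - σ (a * b) ∈ I) :
    ∃ τ : S →ₗ[K] A, τ 1 = 1 ∧ (∀ a, σ a - τ a ∈ I) ∧
      ∀ a b, τ a * τ b - τ (a * b) ∈ I * I := by
  obtain ⟨T, hT1, hT⟩ := hS.exists_finset
  let f : S →ₗ[K] S →ₗ[K] A :=
    (LinearMap.mul K A).compl₁₂ σ σ - (LinearMap.mul K S).compr₂ σ
  have hf (a b : S) : f a b = σ a * σ b - σ (a * b) := rfl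
  have hfI (a b : S) : f a b ∈ I := hI a b
  let g : S →ₗ[K] A := ∑ i ∈ T, LinearMap.mulRight K (σ i.2) ∘ₗ f.flip i.1
  have hg (a : S) : g a = ∑ i ∈ T, f a i.1 * σ i.2 := by simp [g]
  have hgI (a : S) : g a ∈ I := by
    rw [hg]
    exact sum_mem fun i _ ↦ I.mul_mem_right _ (hfI _ _)
  have hcocycle (a b : S) : σ a * g b = g (a * b) - ∑ i ∈ T, f a (b * i.1) * σ i.2 +
      f a b * ∑ i ∈ T, σ i.1 * σ i.2 := by
    simp only [hg, Finset.mul_sum, ← Finset.sum_sub_distrib, ← Finset.sum_add_distrib]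
    refine Finset.sum_congr rfl fun i _ ↦ ?_
    simp only [hf, mul_assoc a b]
    noncomm_ring
  have hcomm (a b : S) : ∑ i ∈ T, f a (b * i.1) * σ i.2 =
      g a * σ b - ∑ i ∈ T, f a i.1 * f i.2 b := by
    have := hT b ((LinearMap.mul K A).compl₁₂ (f a) σ)
    simp only [LinearMap.compl₁₂_apply, LinearMap.mul_apply'] at this
    rw [this, hg, Finset.sum_mul, ← Finset.sum_sub_distrib]
    refine Finset.sum_congr rfl fun i _ ↦ ?_
    rw [hf i.2 b]
    noncomm_ring
  have hone : ∑ i ∈ T, σ i.1 * σ i.2 = 1 + ∑ i ∈ T, f i.1 i.2 := by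
    simp only [hf, Finset.sum_sub_distrib, ← map_sum, hT1, h1]
    abel
  have hg1 : g 1 = 0 := by
    rw [hg]
    exact Finset.sum_eq_zero fun i _ ↦ by simp [hf, h1]
  refine ⟨σ - g, by simp [h1, hg1], fun a ↦ by simpa using hgI a, fun a b ↦ ?_⟩
  have key : (σ - g) a * (σ - g) b - (σ - g) (a * b) =
      g a * g b - ∑ i ∈ T, f a i.1 * f i.2 b - f a b * ∑ i ∈ T, f i.1 i.2 := by
    have h := hcocycle a b
    rw [hcomm, hone] at h
    simp only [LinearMap.sub_apply, sub_mul, mul_sub, h]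
    rw [mul_add, mul_one, hf a b]
    abel
  rw [key]
  exact sub_mem (sub_mem (Ideal.mul_mem_mul (hgI a) (hgI b))
    (sum_mem fun i _ ↦ Ideal.mul_mem_mul (hfI _ _) (hfI _ _)))
    (Ideal.mul_mem_mul (hfI _ _) (sum_mem fun i _ ↦ hfI _ _))

/-- Algebra homomorphisms out of an algebra with a separability element lift along nilpotent
ideals. -/
lemma HasSeparabilityElement.exists_algHom_of_isNilpotent (hS : HasSeparabilityElement K S)
    (I : Ideal A) [I.IsTwoSided] (hnil : IsNilpotent I) (σ : S →ₗ[K] A) (h1 : σ 1 = 1)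
    (hI : ∀ a b, σ a * σ b - σ (a * b) ∈ I) :
    ∃ s : S →ₐ[K] A, ∀ a, σ a - s a ∈ I := by
  have hstep (n : ℕ) : ∃ τ : S →ₗ[K] A, τ 1 = 1 ∧ (∀ a, σ a - τ a ∈ I) ∧
      ∀ a b, τ a * τ b - τ (a * b) ∈ I ^ 2 ^ n := by
    induction n with
    | zero => exact ⟨σ, h1, by simp, by simpa [Submodule.pow_one] using hI⟩
    | succ n ih =>
      obtain ⟨τ, hτ1, hτ, hmul⟩ := ih
      obtain ⟨τ', hτ1', hτ', hmul'⟩ := hS.exists_mul_mem_mul_self τ hτ1 (I ^ 2 ^ n) hmul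
      refine ⟨τ', hτ1', fun a ↦ ?_, fun a b ↦ ?_⟩
      · rw [← sub_add_sub_cancel _ (τ a)]
        exact add_mem (hτ a) (Ideal.pow_le_self (by positivity) (hτ' a))
      · rw [pow_succ, mul_two, Ideal.IsTwoSided.pow_add]
        exact hmul' a b
  obtain ⟨n, hn⟩ := hnil
  obtain ⟨τ, hτ1, hτ, hmul⟩ := hstep n
  refine ⟨.ofLinearMap τ hτ1 fun a b ↦ ?_, hτ⟩
  have h : I ^ 2 ^ n = ⊥ := by
    rw [← Nat.sub_add_cancel Nat.lt_two_pow_self.le, Ideal.IsTwoSided.pow_add, hn]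
    simp
  exact (sub_eq_zero.1 (by simpa [h] using hmul a b)).symm

/-- Two homomorphisms out of an algebra with a separability element which agree modulo an ideal
`I` of nilpotent elements are conjugate. -/
lemma HasSeparabilityElement.exists_unit_mul_eq_mul (hS : HasSeparabilityElement K S)
    (I : Ideal A) [I.IsTwoSided] (hnil : ∀ a ∈ I, IsNilpotent a)
    (φ ψ : S →ₐ[K] A) (h : ∀ a, φ a - ψ a ∈ I) :
    ∃ u : Aˣ, (u : A) - 1 ∈ I ∧ ∀ a, φ a * u = u * ψ a := by
  obtain ⟨T, hT1, hT⟩ := hS.exists_finset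
  have hu : ∑ i ∈ T, φ i.1 * ψ i.2 - 1 ∈ I := by
    rw [← map_one ψ, ← hT1, map_sum, ← Finset.sum_sub_distrib]
    refine sum_mem fun i _ ↦ ?_
    rw [map_mul, ← sub_mul]
    exact I.mul_mem_right _ (h _)
  obtain ⟨u, hu'⟩ : IsUnit (∑ i ∈ T, φ i.1 * ψ i.2) := by
    simpa using (hnil _ hu).isUnit_add_one
  refine ⟨u, hu' ▸ hu, fun a ↦ ?_⟩
  have := hT a ((LinearMap.mul K A).compl₁₂ φ.toLinearMap ψ.toLinearMap)
  simp only [LinearMap.compl₁₂_apply, LinearMap.mul_apply', AlgHom.toLinearMap_apply,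
    map_mul] at this
  simpa [hu', Finset.mul_sum, Finset.sum_mul, mul_assoc] using this

end Lifting

lemma IsNilpotentSet.isNilpotent {R : Type*} [Ring R] {I : Ideal R} [I.IsTwoSided]
    (h : IsNilpotentSet (I : Set R)) : IsNilpotent I := by
  obtain ⟨n, hpos, hn⟩ := h
  have key (m : ℕ) : ∀ a ∈ I ^ (m + 1), ∀ l : List R, (∀ x ∈ l, x ∈ I) →
      l.length + (m + 1) = n → l.prod * a = 0 := by
    induction m with
    | zero =>
      intro a ha l hl hlen
      rw [zero_add, Submodule.pow_one] at ha
      simpa using hn (l ++ [a]) (by simpa [or_imp, forall_and] using ⟨hl, ha⟩) (by simpa using hlen)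
    | succ m ih =>
      intro a ha l hl hlen
      rw [Ideal.IsTwoSided.pow_succ] at ha
      induction ha using Submodule.smul_induction_on' with
      | smul x hx y hy =>
        simpa [mul_assoc] using ih y hy (l ++ [x])
          (by simpa [or_imp, forall_and] using ⟨hl, hx⟩)
          (by rw [← hlen, List.length_append, List.length_singleton]; ring)
      | add x hx y hy hx' hy' => rw [mul_add, hx', hy', add_zero]
  obtain ⟨m, rfl⟩ := Nat.exists_eq_succ_of_ne_zero hpos.ne'
  refine ⟨m + 1, (Submodule.eq_bot_iff _).2 fun a ha ↦ ?_⟩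
  simpa using key m a ha [] (by simp) (by simp)

lemma IsNilpotentSet.isNilpotent_of_mem {R : Type*} [Ring R] {S : Set R}
    (h : IsNilpotentSet S) {a : R} (ha : a ∈ S) : IsNilpotent a := by
  obtain ⟨n, -, hn⟩ := h
  refine ⟨n, ?_⟩
  rw [← List.prod_replicate]
  exact hn _ (fun x hx ↦ List.eq_of_mem_replicate hx ▸ ha) List.length_replicate

lemma mkAlgHom_jacRel_eq_iff {K A : Type*} [Field K] [Ring A] [Algebra K A] {a b : A} :
    RingQuot.mkAlgHom K (jacRel A) a = RingQuot.mkAlgHom K (jacRel A) b ↔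
      a - b ∈ Ideal.jacobson (⊥ : Ideal A) := by
  refine ⟨fun h ↦ ?_, fun h ↦ RingQuot.mkAlgHom_rel K h⟩
  let q := RingQuot.liftAlgHom K (s := jacRel A)
    ⟨Ideal.Quotient.mkₐ K (Ideal.jacobson (⊥ : Ideal A)), fun x y hxy ↦ Ideal.Quotient.eq.2 hxy⟩
  have hq (x : A) : q (RingQuot.mkAlgHom K (jacRel A) x) = Ideal.Quotient.mk _ x :=
    RingQuot.liftAlgHom_mkAlgHom_apply ..
  rw [← Ideal.Quotient.eq, ← hq, ← hq, h]

/-- **Wedderburn–Malcev theorem.** If `A` is a Wedderburn `K`-algebra (its Jacobson radical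
is nilpotent and `A` modulo its Jacobson radical is a separable `K`-algebra) and
`B ⊆ A` is a separable `K`-subalgebra, then the projection `π` of `A` onto its quotient by
the Jacobson radical admits a `K`-algebra section `s` with `s (π b) = b` for all `b ∈ B`. -/
theorem wedderburn_malcev
    (K : Type u) [Field K] (A : Type u) [Ring A] [Algebra K A]
    (hnil : IsNilpotentSet (Ideal.jacobson (⊥ : Ideal A) : Set A))
    (hsep : IsSeparableKAlgebra K (JacQuot A))
    (B : Subalgebra K A) (hB : IsSeparableKAlgebra K B) :
    ∃ s : JacQuot A →ₐ[K] A,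
      (∀ x : JacQuot A, RingQuot.mkAlgHom K (jacRel A) (s x) = x) ∧
      ∀ b : A, b ∈ B → s (RingQuot.mkAlgHom K (jacRel A) b) = b := by
  let J := Ideal.jacobson (⊥ : Ideal A)
  let π := RingQuot.mkAlgHom K (jacRel A)
  have hπ {a b : A} : π a = π b ↔ a - b ∈ J := mkAlgHom_jacRel_eq_iff
  obtain ⟨σ₀, hσ₀⟩ := π.toLinearMap.exists_rightInverse_of_surjective
    (LinearMap.range_eq_top.2 (RingQuot.mkAlgHom_surjective K (jacRel A)))
  replace hσ₀ (x : JacQuot A) : π (σ₀ x) = x := LinearMap.congr_fun hσ₀ x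
  have hone : σ₀ 1 - 1 ∈ J := hπ.1 (by rw [hσ₀, map_one])
  obtain ⟨u, hu⟩ : IsUnit (σ₀ 1) := by
    simpa using (hnil.isNilpotent_of_mem hone).isUnit_add_one
  have hπu : π (u⁻¹ : Aˣ) = 1 := by
    have h := congrArg π u.inv_mul
    rwa [map_mul, hu, hσ₀, mul_one, map_one] at h
  let σ : JacQuot A →ₗ[K] A := LinearMap.mulLeft K ((u⁻¹ : Aˣ) : A) ∘ₗ σ₀
  have hσ (x : JacQuot A) : π (σ x) = x := by simp [σ, hπu, hσ₀]
  obtain ⟨s, hs⟩ := hsep.hasSeparabilityElement.exists_algHom_of_isNilpotent J hnil.isNilpotent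
    σ (by simp [σ, ← hu]) fun a b ↦ hπ.1 (by simp [hσ])
  replace hs (x : JacQuot A) : π (s x) = x := by rw [← hπ.2 (hs x), hσ]
  obtain ⟨v, hv, hv'⟩ := hB.hasSeparabilityElement.exists_unit_mul_eq_mul J
    (fun a ha ↦ hnil.isNilpotent_of_mem ha) ((s.comp π).comp B.val) B.val
    fun b ↦ hπ.1 (hs (π b))
  have hπv : π v = 1 := by rw [← map_one π, hπ]; exact hv
  have hπv' : π (v⁻¹ : Aˣ) = 1 := by
    have h := congrArg π v.inv_mul
    rwa [map_mul, hπv, mul_one, map_one] at h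
  let c : A →ₐ[K] A := .ofLinearMap
    (LinearMap.mulLeft K ((v⁻¹ : Aˣ) : A) ∘ₗ LinearMap.mulRight K (v : A)) (by simp)
    fun a b ↦ by simp [mul_assoc]
  have hc (a : A) : c a = (v⁻¹ : Aˣ) * (a * v) := rfl
  refine ⟨c.comp s, fun x ↦ ?_, fun b hb ↦ ?_⟩
  · change π (c (s x)) = x
    simp [hc, hs, hπv, hπv']
  · change c (s (π b)) = b
    rw [hc, Units.inv_mul_eq_iff_eq_mul]
    exact hv' ⟨b, hb⟩
end

section
/- Let K be a field, L a field extension of K, V a finite-dimensional L-vector space, and A a K-subalgebra of the K-algebra End_L(V) of L-linear endomorphisms of V (an L-algebra, viewed as a K-algebra via K ⊆ L). Assume that for every a ∈ A the characteristic polynomial of a acting on the L-vector space V has all its coefficients in the image of K in L. Let R be the Jacobson radical of A and let n = dim_L V. Then every u ∈ R satisfies uⁿ = 0, and R is nilpotent of index at most n, i.e. any product of n elements of R is zero. -/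
universe u

open Module Polynomial

section Levitzki

variable {L V : Type*} [Field L] [AddCommGroup V] [Module L V]

theorem finrank_range_mul_lt_of_isNilpotent [FiniteDimensional L V] {a c : End L V}
    (hc : IsNilpotent c) (ha : a ≠ 0)
    (hle : LinearMap.range (c * a) ≤ LinearMap.range a) :
    finrank L (LinearMap.range (c * a)) < finrank L (LinearMap.range a) := by
  refine Submodule.finrank_lt_finrank_of_lt (lt_of_le_of_ne hle fun h => ha ?_)
  have hmap (k : ℕ) : LinearMap.range (c ^ k * a) = LinearMap.range a := by
    induction k with
    | zero => simp
    | succ k ih =>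
      rw [pow_succ, mul_assoc, Module.End.mul_eq_comp, LinearMap.range_comp, h,
        ← LinearMap.range_comp, ← Module.End.mul_eq_comp, ih]
  obtain ⟨k, hk⟩ := hc
  have := hmap k
  rw [hk, zero_mul, LinearMap.range_zero] at this
  exact LinearMap.range_eq_bot.mp this.symm

theorem exists_invariant_submodule_of_isNilpotent [FiniteDimensional L V]
    {σ : Type*} [Semigroup σ] (ρ : σ →ₙ* End L V) (hρ : ∀ s, IsNilpotent (ρ s))
    (hne : ∃ s, ρ s ≠ 0) :
    ∃ W : Submodule L V, W ≠ ⊥ ∧ W ≠ ⊤ ∧ ∀ s, W ≤ W.comap (ρ s) := by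
  classical
  obtain ⟨s, hs, hmin⟩ : ∃ s, ρ s ≠ 0 ∧ ∀ t, ρ t ≠ 0 →
      finrank L (LinearMap.range (ρ s)) ≤ finrank L (LinearMap.range (ρ t)) := by
    have hex : ∃ n s, ρ s ≠ 0 ∧ finrank L (LinearMap.range (ρ s)) = n :=
      let ⟨s, hs⟩ := hne; ⟨_, s, hs, rfl⟩
    obtain ⟨s, hs, hsn⟩ := Nat.find_spec hex
    exact ⟨s, hs, fun t ht => hsn ▸ Nat.find_min' hex ⟨t, ht, rfl⟩⟩
  have hsq : ρ s * ρ s = 0 := by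
    by_contra h
    rw [← map_mul] at h
    refine (hmin _ h).not_gt ?_
    rw [map_mul]
    exact finrank_range_mul_lt_of_isNilpotent (hρ s) hs (LinearMap.range_comp_le_range _ _)
  have hsts (t : σ) : ρ s * ρ t * ρ s = 0 := by
    by_contra h
    rw [← map_mul, ← map_mul] at h
    refine (hmin _ h).not_gt ?_
    rw [map_mul]
    refine finrank_range_mul_lt_of_isNilpotent (hρ _) hs ?_
    rw [map_mul, mul_assoc]
    exact LinearMap.range_comp_le_range _ _
  refine ⟨LinearMap.range (ρ s) ⊔ ⨆ t, LinearMap.range (ρ t * ρ s), fun h => ?_, fun h => ?_,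
    fun t => ?_⟩
  · exact hs (LinearMap.range_eq_bot.mp (eq_bot_iff.mpr (h ▸ le_sup_left)))
  · refine hs (LinearMap.ker_eq_top.mp (eq_top_iff.mpr (h ▸ sup_le ?_ (iSup_le fun t => ?_))))
    · exact LinearMap.range_le_ker_iff.mpr hsq
    · refine LinearMap.range_le_ker_iff.mpr ?_
      rw [← Module.End.mul_eq_comp, ← mul_assoc, hsts]
  · refine sup_le ?_ (iSup_le fun r => ?_)
    · rw [← Submodule.map_le_iff_le_comap, ← LinearMap.range_comp]
      exact le_sup_of_le_right (le_iSup (fun t => LinearMap.range (ρ t * ρ s)) t)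
    · rw [← Submodule.map_le_iff_le_comap, ← LinearMap.range_comp, ← Module.End.mul_eq_comp,
        ← mul_assoc, ← map_mul]
      exact le_sup_of_le_right (le_iSup (fun t => LinearMap.range (ρ t * ρ s)) (t * r))

/-- The action on an invariant subspace. -/
def MulHom.restrictEnd {σ : Type*} [Semigroup σ] (ρ : σ →ₙ* End L V) (W : Submodule L V)
    (hW : ∀ s, W ≤ W.comap (ρ s)) : σ →ₙ* End L W where
  toFun s := (ρ s).restrict (hW s)
  map_mul' s t := by ext; simp

/-- The action on the quotient by an invariant subspace. -/
def MulHom.quotientEnd {σ : Type*} [Semigroup σ] (ρ : σ →ₙ* End L V) (W : Submodule L V)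
    (hW : ∀ s, W ≤ W.comap (ρ s)) : σ →ₙ* End L (V ⧸ W) where
  toFun s := W.mapQ W (ρ s) (hW s)
  map_mul' s t := by ext; simp

section

variable {σ : Type*} [Semigroup σ] (ρ : σ →ₙ* End L V) (W : Submodule L V)
    (hW : ∀ s, W ≤ W.comap (ρ s))

theorem MulHom.coe_restrictEnd_pow_apply (s : σ) (k : ℕ) (w : W) :
    ((ρ.restrictEnd W hW s ^ k) w : V) = (ρ s ^ k) w := by
  induction k with
  | zero => simp
  | succ k ih => simpa [pow_succ', restrictEnd] using congrArg (ρ s) ih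

theorem MulHom.quotientEnd_pow_apply_mk (s : σ) (k : ℕ) (v : V) :
    (ρ.quotientEnd W hW s ^ k) (W.mkQ v) = W.mkQ ((ρ s ^ k) v) := by
  induction k with
  | zero => simp
  | succ k ih =>
    rw [pow_succ', Module.End.mul_apply, ih, pow_succ', Module.End.mul_apply]
    rfl

theorem MulHom.coe_restrictEnd_prod_apply (l : List σ) (w : W) :
    ((l.map (ρ.restrictEnd W hW)).prod w : V) = (l.map ρ).prod w := by
  induction l with
  | nil => simp
  | cons s l ih => simpa [restrictEnd] using congrArg (ρ s) ih

theorem MulHom.quotientEnd_prod_apply_mk (l : List σ) (v : V) :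
    (l.map (ρ.quotientEnd W hW)).prod (W.mkQ v) = W.mkQ ((l.map ρ).prod v) := by
  induction l with
  | nil => simp
  | cons s l ih =>
    rw [List.map_cons, List.prod_cons, Module.End.mul_apply, ih, List.map_cons, List.prod_cons,
      Module.End.mul_apply]
    rfl

end

/-- Levitzki's theorem: in a semigroup of nilpotent endomorphisms of a vector space of
dimension `n`, every product of `n` elements vanishes. -/
theorem prod_map_eq_zero_of_forall_isNilpotent [FiniteDimensional L V] (n : ℕ)
    {σ : Type*} [Semigroup σ] (ρ : σ →ₙ* End L V) (hρ : ∀ s, IsNilpotent (ρ s))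
    (hn : finrank L V = n) (l : List σ) (hl : l.length = n) : (l.map ρ).prod = 0 := by
  induction n using Nat.strong_induction_on generalizing V l with
  | _ n ih =>
  by_cases hne : ∃ s, ρ s ≠ 0
  · obtain ⟨W, hbot, htop, hW⟩ := exists_invariant_submodule_of_isNilpotent ρ hρ hne
    have hadd := W.finrank_quotient_add_finrank
    have hlt := Submodule.finrank_lt htop
    have hpos : 0 < finrank L W := Module.finrank_pos_iff.mpr
      (Submodule.nontrivial_iff_ne_bot.mpr hbot)
    have h₁ := ih (finrank L W) (by omega) (ρ.restrictEnd W hW)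
      (fun s => (hρ s).imp fun k hk => by
        ext w; simp [MulHom.coe_restrictEnd_pow_apply, hk])
      rfl (l.take (finrank L W)) (by simp; omega)
    have h₂ := ih (finrank L (V ⧸ W)) (by omega) (ρ.quotientEnd W hW)
      (fun s => (hρ s).imp fun k hk => by
        refine Submodule.linearMap_qext _ (LinearMap.ext fun v => ?_)
        rw [LinearMap.comp_apply, MulHom.quotientEnd_pow_apply_mk, hk]
        simp)
      rfl (l.drop (finrank L W)) (by simp; omega)
    ext v
    have hv : ((l.drop (finrank L W)).map ρ).prod v ∈ W := by
      rw [← Submodule.Quotient.mk_eq_zero, ← Submodule.mkQ_apply,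
        ← MulHom.quotientEnd_prod_apply_mk ρ W hW, h₂, LinearMap.zero_apply]
    rw [← List.take_append_drop (finrank L W) l, List.map_append, List.prod_append,
      Module.End.mul_apply]
    have := MulHom.coe_restrictEnd_prod_apply ρ W hW (l.take (finrank L W)) ⟨_, hv⟩
    rw [h₁] at this
    simpa using this.symm
  · push Not at hne
    cases l with
    | nil =>
      have : Subsingleton V := Module.finrank_zero_iff.mp (hn.trans hl.symm)
      exact Subsingleton.elim _ _
    | cons s l => simp [hne s]

end Levitzki

theorem pow_natDegree_eq_zero_of_mem_jacobson_bot {K A : Type*} [Field K] [Ring A] [Algebra K A]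
    {u : A} (hu : u ∈ Ideal.jacobson (⊥ : Ideal A)) {f : K[X]} (hf : f ≠ 0)
    (hfu : aeval u f = 0) : u ^ f.natDegree = 0 := by
  obtain ⟨g, hg, hdvd⟩ := f.exists_eq_pow_rootMultiplicity_mul_and_not_dvd hf 0
  set k := f.rootMultiplicity 0
  have hk : k ≤ f.natDegree := by
    simpa using natDegree_le_of_dvd (f.pow_rootMultiplicity_dvd 0) hf
  rw [C_0, sub_zero] at hg hdvd
  rw [X_dvd_iff] at hdvd
  obtain ⟨z, hz⟩ := Ideal.mem_jacobson_iff.mp hu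
    (algebraMap K A (g.coeff 0)⁻¹ * aeval u g.divX)
  have hgu : aeval u g = aeval u g.divX * u + algebraMap K A (g.coeff 0) := by
    conv_lhs => rw [← g.divX_mul_X_add]
    simp
  have hinv : z * algebraMap K A (g.coeff 0)⁻¹ * aeval u g = 1 := by
    rw [hgu, mul_add, mul_assoc z _ (algebraMap K A _), ← map_mul, inv_mul_cancel₀ hdvd]
    rw [Ideal.mem_bot, sub_eq_zero] at hz
    simpa [mul_assoc] using hz
  have hzero : aeval u g * u ^ k = 0 := by
    rw [hg, mul_comm] at hfu
    simpa using hfu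
  refine pow_eq_zero_of_le hk ?_
  rw [← one_mul (u ^ k), ← hinv, mul_assoc, hzero, mul_zero]

/-- Let `V` be a finite-dimensional `L`-vector space and `A` a `K`-subalgebra of
`End_L(V)` such that the characteristic polynomial of every element of `A` has
coefficients in (the image of) `K`. Then every element `u` of the Jacobson radical `R`
of `A` satisfies `u ^ n = 0`, and `R` is nilpotent of index at most `n = dim_L V`:
every product of `n` elements of `R` vanishes. -/
theorem charpoly_in_base_jacobson_nilpotent
    (K : Type u) [Field K] (L : Type u) [Field L] [Algebra K L]
    (V : Type u) [AddCommGroup V] [Module L V] [FiniteDimensional L V]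
    [Module K V] [IsScalarTower K L V]
    (A : Subalgebra K (Module.End L V))
    (hA : ∀ a : A, ∀ i : ℕ,
      (LinearMap.charpoly (A.val a)).coeff i ∈ Set.range (algebraMap K L)) :
    (∀ u : A, u ∈ Ideal.jacobson (⊥ : Ideal A) → u ^ Module.finrank L V = 0) ∧
    ∀ l : List A, (∀ x ∈ l, x ∈ Ideal.jacobson (⊥ : Ideal A)) →
      l.length = Module.finrank L V → l.prod = 0 := by
  have hpow (u : A) (hu : u ∈ Ideal.jacobson (⊥ : Ideal A)) : u ^ Module.finrank L V = 0 := by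
    obtain ⟨f, hf⟩ : ∃ f : K[X], f.map (algebraMap K L) = (A.val u).charpoly :=
      (Polynomial.mem_lifts _).mp ((Polynomial.lifts_iff_coeff_lifts _).mpr (hA u))
    have hdeg : f.natDegree = Module.finrank L V := by
      rw [← LinearMap.charpoly_natDegree (A.val u), ← hf, Polynomial.natDegree_map]
    rw [← hdeg]
    refine pow_natDegree_eq_zero_of_mem_jacobson_bot hu ?_ ?_
    · rintro rfl
      exact (A.val u).charpoly_monic.ne_zero (by rw [← hf, Polynomial.map_zero])
    · apply Subtype.val_injective
      change A.val (aeval u f) = 0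
      rw [← Polynomial.aeval_algHom_apply, ← Polynomial.aeval_map_algebraMap L, hf,
        LinearMap.aeval_self_charpoly]
  refine ⟨hpow, fun l hl hlen => ?_⟩
  let S : Subsemigroup A :=
    { carrier := Ideal.jacobson (⊥ : Ideal A)
      mul_mem' := fun {a _} _ hb => Ideal.mul_mem_left _ a hb }
  let ρ : S →ₙ* Module.End L V := (A.val : A →ₙ* Module.End L V).comp (MulMemClass.subtype S)
  have hρ (s : S) : IsNilpotent (ρ s) :=
    IsNilpotent.map (f := A.val) ⟨_, hpow s.1 s.2⟩
  have hprod := prod_map_eq_zero_of_forall_isNilpotent _ ρ hρ rfl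
    (l.attachWith (· ∈ S) hl) (by simpa using hlen)
  apply Subtype.val_injective
  change A.val l.prod = 0
  rw [map_list_prod, ← hprod]
  conv_lhs => rw [← List.attachWith_map_subtype_val hl, List.map_map]
  rfl
end
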